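/- arXiv:1807.10155 — 2 statements merged into one kernel-verified Lean document; each statement's English description precedes it below -/
import Mathlib

section
/- Let (X,T) be a transitive topological dynamical system. Then (X,T) is disjoint from every minimal topological dynamical system if and only if (X,T) is weakly mixing and for every minimal t.d.s. (Y,S), every nonempty open set U ⊆ X and every nonempty open set V ⊆ Y, there exists a point x ∈ U (depending only on U and V) such that for every y ∈ V the set N_{T×S}((x,y), U×V) = {n ∈ ℤ₊ : T^n x ∈ U and S^n y ∈ V} is syndetic. -/
open Set Function Filter Topology

structure TDS where
  carrier : Type
  [ms : MetricSpace carrier]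
  [cs : CompactSpace carrier]
  map : carrier → carrier
  cont : Continuous map
  surj : Function.Surjective map

attribute [instance] TDS.ms TDS.cs

def orbit {X : Type*} (T : X → X) (x : X) : Set X :=
  Set.range fun n : ℕ => T^[n] x

def IsMinimalSys {Y : Type*} [TopologicalSpace Y] (S : Y → Y) : Prop :=
  ∀ y : Y, Dense (orbit S y)

def IsTransitiveSys {X : Type*} [TopologicalSpace X] (T : X → X) : Prop :=
  ∀ U V : Set X, IsOpen U → IsOpen V → U.Nonempty → V.Nonempty →
    {n : ℕ | (U ∩ T^[n] ⁻¹' V).Nonempty}.Infinite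

def IsWeaklyMixingSys {X : Type*} [TopologicalSpace X] (T : X → X) : Prop :=
  IsTransitiveSys fun p : X × X => (T p.1, T p.2)

def IsJoining {X Y : Type*} [TopologicalSpace X] [TopologicalSpace Y]
    (T : X → X) (S : Y → Y) (J : Set (X × Y)) : Prop :=
  J.Nonempty ∧ IsClosed J ∧ (∀ p ∈ J, (T p.1, S p.2) ∈ J) ∧
    Prod.fst '' J = Set.univ ∧ Prod.snd '' J = Set.univ

def DisjointSys {X Y : Type*} [TopologicalSpace X] [TopologicalSpace Y]
    (T : X → X) (S : Y → Y) : Prop :=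
  ∀ J : Set (X × Y), IsJoining T S J → J = Set.univ

def Syndetic (A : Set ℕ) : Prop :=
  ∃ N : ℕ, ∀ i : ℕ, ∃ j ≤ N, i + j ∈ A

def Thick (A : Set ℕ) : Prop :=
  ∀ L : ℕ, ∃ n : ℕ, ∀ j ≤ L, n + j ∈ A

def IsMinimalPoint {X : Type*} [TopologicalSpace X] (T : X → X) (x : X) : Prop :=
  ∀ y ∈ closure (orbit T x), closure (orbit T x) ⊆ closure (orbit T y)

def Proximal {X : Type*} [MetricSpace X] (T : X → X) (x y : X) : Prop :=
  ∃ u : ℕ → ℕ, Filter.Tendsto (fun i => dist (T^[u i] x) (T^[u i] y)) Filter.atTop (nhds 0)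

def IsDistalPoint {X : Type*} [MetricSpace X] (T : X → X) (x : X) : Prop :=
  ∀ y ∈ closure (orbit T x), Proximal T x y → y = x

def DynSyndetic (B : Set ℕ) : Prop :=
  ∃ 𝒴 : TDS, IsMinimalSys 𝒴.map ∧
    ∃ (y : 𝒴.carrier) (V : Set 𝒴.carrier),
      IsOpen V ∧ y ∈ V ∧ {n : ℕ | 𝒴.map^[n] y ∈ V} ⊆ B

def CentralSet (S : Set ℕ) : Prop :=
  ∃ 𝒵 : TDS, ∃ (z w : 𝒵.carrier) (W : Set 𝒵.carrier),
    IsMinimalPoint 𝒵.map w ∧ Proximal 𝒵.map z w ∧ IsOpen W ∧ w ∈ W ∧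
    {n : ℕ | 𝒵.map^[n] z ∈ W} ⊆ S

def CStarSet (A : Set ℕ) : Prop :=
  ∀ S : Set ℕ, CentralSet S → (A ∩ S).Nonempty


/-- The words obtained by concatenating finitely many words of `B`. -/
def concatenations {α : Type*} (B : Set (List α)) : Set (List α) :=
  {w | ∃ L : List (List α), (∀ b ∈ L, b ∈ B) ∧ L.flatten = w}

lemma mem_concatenations_of_mem {α : Type*} {B : Set (List α)} {w : List α} (h : w ∈ B) :
    w ∈ concatenations B := ⟨[w], by simpa using h, by simp⟩

lemma append_mem_concatenations {α : Type*} {B : Set (List α)} {v w : List α}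
    (hv : v ∈ concatenations B) (hw : w ∈ concatenations B) : v ++ w ∈ concatenations B := by
  obtain ⟨L, hL, rfl⟩ := hv
  obtain ⟨M, hM, rfl⟩ := hw
  refine ⟨L ++ M, fun b hb => ?_, by simp⟩
  rcases List.mem_append.1 hb with h | h
  exacts [hL b h, hM b h]

lemma concatenations_subset {α : Type*} {B C : Set (List α)} (h : C ⊆ concatenations B) :
    concatenations C ⊆ concatenations B := by
  rintro w ⟨L, hL, rfl⟩
  induction L with
  | nil => exact ⟨[], by simp, rfl⟩
  | cons c L ih =>
    rw [List.flatten_cons]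
    exact append_mem_concatenations (h (hL c (by simp))) (ih fun b hb => hL b (by simp [hb]))

lemma exists_getElem?_eq_of_isInfix {α : Type*} {b c : List α} (h : b <:+: c) (r : List α) :
    ∃ t ≤ c.length, ∀ s < b.length, (c ++ r)[t + s]? = b[s]? := by
  obtain ⟨p, q, rfl⟩ := h
  refine ⟨p.length, by simp, fun s hs => ?_⟩
  simp only [List.append_assoc]
  rw [List.getElem?_append_right (by omega), List.getElem?_append_left (by omega)]
  simp

/-- A word that is an infix of every block of length at most `M` recurs with gaps at most `2 * M`
in every concatenation of blocks. -/
lemma exists_getElem?_eq_of_mem_concatenations {α : Type*} {B : Set (List α)} {b : List α} {M : ℕ}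
    (hM : 0 < M) (hB : ∀ c ∈ B, c.length ≤ M ∧ b <:+: c) {w : List α} (hw : w ∈ concatenations B)
    (i : ℕ) (hi : i + M ≤ w.length) :
    ∃ t ≤ 2 * M, ∀ s < b.length, w[i + t + s]? = b[s]? := by
  obtain ⟨L, hL, rfl⟩ := hw
  induction L generalizing i with
  | nil => simp at hi; omega
  | cons c L ih =>
    have hc := hB c (hL c (by simp))
    rw [List.flatten_cons] at hi ⊢
    rw [List.length_append] at hi
    rcases Nat.eq_zero_or_pos i with rfl | hi0
    · obtain ⟨t, ht, h⟩ := exists_getElem?_eq_of_isInfix hc.2 L.flatten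
      exact ⟨t, by omega, by simpa using h⟩
    rcases le_or_gt c.length i with hci | hci
    · obtain ⟨t, ht, h⟩ := ih (i - c.length) (fun b hb => hL b (by simp [hb])) (by omega)
      refine ⟨t, ht, fun s hs => ?_⟩
      rw [← h s hs, List.getElem?_append_right (by omega)]
      congr 1
      omega
    · cases L with
      | nil => simp at hi; omega
      | cons d L =>
        have hd := hB d (hL d (by simp))
        obtain ⟨t, ht, h⟩ := exists_getElem?_eq_of_isInfix hd.2 L.flatten
        refine ⟨c.length - i + t, by omega, fun s hs => ?_⟩
        rw [← h s hs, List.getElem?_append_right (by omega), List.flatten_cons]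
        congr 1
        omega

lemma Set.Finite.exists_mem_concatenations {α : Type*} {B : Set (List α)} (hB : B.Finite) :
    ∃ w ∈ concatenations B, ∀ b ∈ B, b <:+: w := by
  refine ⟨hB.toFinset.toList.flatten, ⟨_, fun b hb => by simpa using hb, rfl⟩, fun b hb => ?_⟩
  exact List.infix_of_mem_flatten (by simpa using hb)

/-- A finite set of blocks of lengths between `l` and `2 * l` whose concatenations realise every
length at least `l`, at every place, by a word whose letters `true` stay in `D`. -/
structure IsBlockFamily (D : Set ℕ) (B : Set (List Bool)) (l : ℕ) : Prop where
  finite : B.Finite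
  pos : 0 < l
  le_length : ∀ b ∈ B, l ≤ b.length
  length_le : ∀ b ∈ B, b.length ≤ 2 * l
  exists_word : ∀ n, l ≤ n → ∀ a, ∃ w ∈ concatenations B, w.length = n ∧
    ∀ i, w[i]? = some true → a + i ∈ D

lemma isBlockFamily_letters (D : Set ℕ) : IsBlockFamily D {[true], [false]} 1 where
  finite := by simp
  pos := one_pos
  le_length := by simp
  length_le := by simp
  exists_word n _ a := by
    refine ⟨List.replicate n false, ⟨List.replicate n [false], ?_, ?_⟩, by simp, ?_⟩
    · intro b hb
      simp [List.eq_of_mem_replicate hb]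
    · simp
    · intro i hi
      simp [List.getElem?_replicate] at hi

lemma IsBlockFamily.exists_next {D : Set ℕ}
    (hD : ∀ L, ∃ G, ∀ a, ∃ p ≤ G, ∀ s < L, a + p + s ∈ D) {B : Set (List Bool)} {l : ℕ}
    (h : IsBlockFamily D B l) :
    ∃ (C : Set (List Bool)) (m : ℕ), IsBlockFamily D C m ∧ l < m ∧ C ⊆ concatenations B ∧
      ∀ c ∈ C, ∀ b ∈ B, b <:+: c := by
  obtain ⟨W, hW, hWB⟩ := h.finite.exists_mem_concatenations
  obtain ⟨G, hG⟩ := hD W.length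
  have hl := h.pos
  set m := 2 * l + W.length + G with hm
  set C : Set (List Bool) :=
    {w | w ∈ concatenations B ∧ m ≤ w.length ∧ w.length ≤ 2 * m ∧ ∀ b ∈ B, b <:+: w}
  refine ⟨C, m, ⟨?_, by omega, fun b hb => hb.2.1, fun b hb => hb.2.2.1, ?_⟩, by omega,
    fun w hw => hw.1, fun c hc => hc.2.2.2⟩
  · exact (List.finite_length_le Bool (2 * m)).subset fun w hw => hw.2.2.1
  · intro n
    induction n using Nat.strong_induction_on with
    | _ n ih =>
    intro hn a
    have block : ∀ k, m ≤ k → k ≤ 2 * m → ∃ w ∈ C, w.length = k ∧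
        ∀ i, w[i]? = some true → a + i ∈ D := by
      intro k hk hk2
      obtain ⟨p, hp, hpD⟩ := hG (a + l)
      obtain ⟨u, hu, hul, huD⟩ := h.exists_word (l + p) (by omega) a
      obtain ⟨v, hv, hvl, hvD⟩ := h.exists_word (k - (l + p + W.length)) (by omega)
        (a + (l + p + W.length))
      have hlen : (u ++ W ++ v).length = k := by simp; omega
      refine ⟨u ++ W ++ v, ⟨append_mem_concatenations (append_mem_concatenations hu hW) hv,
        by omega, by omega, fun b hb => (hWB b hb).trans ⟨u, v, rfl⟩⟩, hlen, fun i hi => ?_⟩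
      rw [List.append_assoc] at hi
      rcases lt_or_ge i u.length with h1 | h1
      · rw [List.getElem?_append_left h1] at hi
        exact huD i hi
      rw [List.getElem?_append_right h1] at hi
      rcases lt_or_ge (i - u.length) W.length with h2 | h2
      · convert hpD _ h2 using 1
        omega
      rw [List.getElem?_append_right h2] at hi
      convert hvD _ hi using 1
      omega
    rcases le_or_gt n (2 * m) with hn2 | hn2
    · obtain ⟨w, hw, hw'⟩ := block n hn hn2
      exact ⟨w, mem_concatenations_of_mem hw, hw'⟩
    · obtain ⟨u, hu, hul, huD⟩ := block m le_rfl (by omega)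
      obtain ⟨v, hv, hvl, hvD⟩ := ih (n - m) (by omega) (by omega) (a + m)
      refine ⟨u ++ v, append_mem_concatenations (mem_concatenations_of_mem hu) hv,
        by simp; omega, fun i hi => ?_⟩
      rcases lt_or_ge i u.length with h1 | h1
      · rw [List.getElem?_append_left h1] at hi
        exact huD i hi
      rw [List.getElem?_append_right h1] at hi
      convert hvD _ hi using 1
      omega

/-- Every thickly syndetic set contains the set of visits of a nonzero uniformly recurrent
sequence to the cylinder of `true`. -/
theorem exists_uniformlyRecurrent_of_thicklySyndetic {D : Set ℕ}
    (hD : ∀ L, ∃ G, ∀ a, ∃ p ≤ G, ∀ s < L, a + p + s ∈ D) :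
    ∃ y : ℕ → Bool, (∀ n, y n = true → n ∈ D) ∧ (∃ n, y n = true) ∧
      ∀ m, ∃ R, ∀ i, ∃ t ≤ R, ∀ s < m, y (i + t + s) = y s := by
  choose! C m hC hlt hsub hinf using
    fun (B : Set (List Bool)) (l : ℕ) (h : IsBlockFamily D B l) => h.exists_next hD
  let F : ℕ → Set (List Bool) × ℕ :=
    fun k => (fun q : Set (List Bool) × ℕ => (C q.1 q.2, m q.1 q.2))^[k] ({[true], [false]}, 1)
  have hFs : ∀ k, F (k + 1) = (C (F k).1 (F k).2, m (F k).1 (F k).2) := fun k =>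
    iterate_succ_apply' _ _ _
  have hF : ∀ k, IsBlockFamily D (F k).1 (F k).2 := by
    intro k
    induction k with
    | zero => exact isBlockFamily_letters D
    | succ k ih => rw [hFs]; exact hC _ _ ih
  have hFsub : ∀ k, (F (k + 1)).1 ⊆ concatenations (F k).1 := fun k => by
    rw [hFs]; exact hsub _ _ (hF k)
  have hFinf : ∀ k, ∀ c ∈ (F (k + 1)).1, ∀ b ∈ (F k).1, b <:+: c := fun k => by
    rw [hFs]; exact hinf _ _ (hF k)
  have hmono : StrictMono fun k => (F k).2 := strictMono_nat_of_lt_succ fun k => by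
    rw [hFs]; exact hlt _ _ (hF k)
  have hanti : Antitone fun k => concatenations (F k).1 :=
    antitone_nat_of_succ_le fun k => concatenations_subset (hFsub k)
  choose w hw hwl hwD using fun k => (hF k).exists_word (F k).2 le_rfl 0
  have hwk : ∀ k, k ≤ (w k).length := fun k => by
    rw [hwl]; exact hmono.le_apply
  obtain ⟨y, -, φ, hφ, hy⟩ := isCompact_univ.tendsto_subseq
    (x := fun (k n : ℕ) => ((w k)[n]?).getD false) (fun _ => mem_univ _)
  have happrox : ∀ N K, ∃ k ≥ K, ∀ n < N, (w k)[n]? = some (y n) := by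
    intro N K
    have h1 : ∀ᶠ k in atTop, ∀ n ∈ Finset.range N, ((w (φ k))[n]?).getD false = y n := by
      rw [Filter.eventually_all_finset]
      intro n _
      have := tendsto_pi_nhds.1 hy n
      rw [nhds_discrete, tendsto_pure] at this
      exact this
    obtain ⟨k, hk, hkK⟩ := (h1.and (eventually_ge_atTop (max N K))).exists
    have hφk : max N K ≤ φ k := hkK.trans hφ.le_apply
    refine ⟨φ k, (le_max_right _ _).trans hφk, fun n hn => ?_⟩
    have hlen : n < (w (φ k)).length :=
      hn.trans_le ((le_max_left _ _).trans (hφk.trans (hwk _)))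
    rw [← hk n (Finset.mem_range.2 hn), List.getElem?_eq_getElem hlen, Option.getD_some]
  have hrec : ∀ j, ∀ b ∈ (F j).1, ∀ k ≥ j + 1, ∀ i, i + 2 * (F (j + 1)).2 ≤ (w k).length →
      ∃ t ≤ 2 * (2 * (F (j + 1)).2), ∀ s < b.length, (w k)[i + t + s]? = b[s]? := by
    intro j b hb k hk i hi
    refine exists_getElem?_eq_of_mem_concatenations (by have := (hF (j + 1)).pos; omega)
      (fun c hc => ⟨(hF (j + 1)).length_le c hc, hFinf j c hc b hb⟩) (hanti hk (hw k)) i hi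
  refine ⟨y, fun n hn => ?_, ?_, fun j => ?_⟩
  · obtain ⟨k, -, hk⟩ := happrox (n + 1) 0
    simpa using hwD k n (by rw [hk n (by omega), hn])
  · obtain ⟨k, hk, hky⟩ := happrox (2 * (2 * (F (0 + 1)).2) + 1) (1 + 2 * (F (0 + 1)).2)
    obtain ⟨t, ht, h⟩ := hrec 0 [true] (by simp [F]) k (by omega) 0
      (by have := hwk k; omega)
    refine ⟨t, ?_⟩
    have := h 0 (by simp)
    rw [zero_add, add_zero, hky t (by omega)] at this
    simpa using this
  · refine ⟨2 * (2 * (F (j + 1)).2), fun i => ?_⟩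
    obtain ⟨k, hk, hky⟩ := happrox (i + 2 * (2 * (F (j + 1)).2) + j)
      (j + 1 + i + 2 * (F (j + 1)).2)
    obtain ⟨L, hL, hLw⟩ := hanti (show j ≤ k by omega) (hw k)
    obtain _ | ⟨c, L⟩ := L
    · have := hwk k
      rw [← hLw] at this
      simp at this
      omega
    have hc : c ∈ (F j).1 := hL c (by simp)
    have hcl : j ≤ c.length := (hmono.le_apply (x := j)).trans ((hF j).le_length c hc)
    obtain ⟨t, ht, h⟩ := hrec j c hc k (by omega) i (by have := hwk k; omega)
    refine ⟨t, ht, fun s hs => Option.some_injective _ ?_⟩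
    rw [← hky _ (by omega), ← hky _ (by omega), h s (by omega), ← hLw, List.flatten_cons,
      List.getElem?_append_left (by omega)]

lemma iterate_mem {X : Type*} {T : X → X} {K : Set X} (hK : ∀ x ∈ K, T x ∈ K) {x : X}
    (hx : x ∈ K) (n : ℕ) : T^[n] x ∈ K := by
  induction n with
  | zero => exact hx
  | succ n ih => rw [iterate_succ_apply']; exact hK _ ih

lemma prodMap_iterate_mem {X Y : Type*} {T : X → X} {S : Y → Y} {J : Set (X × Y)}
    (hJ : ∀ p ∈ J, (T p.1, S p.2) ∈ J) {x : X} {y : Y} (h : (x, y) ∈ J) (n : ℕ) :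
    (T^[n] x, S^[n] y) ∈ J := by
  have := iterate_mem (T := Prod.map T S) hJ h n
  rwa [Prod.map_iterate] at this

section Orbits

variable {X : Type*} [TopologicalSpace X]

lemma mem_closure_orbit_self (T : X → X) (x : X) : x ∈ closure (orbit T x) :=
  subset_closure ⟨0, rfl⟩

lemma closure_orbit_subset {T : X → X} {K : Set X} (hK : ∀ x ∈ K, T x ∈ K) (hKc : IsClosed K)
    {x : X} (hx : x ∈ K) : closure (orbit T x) ⊆ K :=
  closure_minimal (range_subset_iff.2 (iterate_mem hK hx)) hKc

lemma map_mem_closure_orbit {T : X → X} (hT : Continuous T) {x y : X}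
    (hy : y ∈ closure (orbit T x)) : T y ∈ closure (orbit T x) := by
  refine map_mem_closure hT hy ?_
  rintro _ ⟨n, rfl⟩
  exact ⟨n + 1, iterate_succ_apply' _ _ _⟩

lemma IsMinimalPoint.of_mem_closure_orbit {T : X → X} (hT : Continuous T) {x y : X}
    (hx : IsMinimalPoint T x) (hy : y ∈ closure (orbit T x)) : IsMinimalPoint T y := by
  have h : closure (orbit T y) ⊆ closure (orbit T x) :=
    closure_orbit_subset (fun _ => map_mem_closure_orbit hT) isClosed_closure hy
  exact fun z hz => h.trans (hx z (h hz))

/-- Every nonempty closed invariant set contains a minimal point. -/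
lemma exists_isMinimalPoint_mem [CompactSpace X] {T : X → X} (hT : Continuous T) {K : Set X}
    (hK : ∀ x ∈ K, T x ∈ K) (hKc : IsClosed K) (hKn : K.Nonempty) :
    ∃ x ∈ K, IsMinimalPoint T x := by
  obtain ⟨M, hMK, hM⟩ := zorn_superset_nonempty
    {C : Set X | IsClosed C ∧ C.Nonempty ∧ ∀ x ∈ C, T x ∈ C} (fun c hc hchain hcn => by
      refine ⟨⋂₀ c, ⟨isClosed_sInter fun s hs => (hc hs).1, ?_, fun x hx s hs =>
        (hc hs).2.2 x (hx s hs)⟩, fun s hs => sInter_subset_of_mem hs⟩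
      have := hcn.to_subtype
      rw [sInter_eq_iInter]
      exact IsCompact.nonempty_iInter_of_directed_nonempty_isCompact_isClosed _
        (fun s t => (hchain.total s.2 t.2).elim (fun h => ⟨s, Subset.rfl, h⟩)
          fun h => ⟨t, h, Subset.rfl⟩)
        (fun s => (hc s.2).2.1) (fun s => (hc s.2).1.isCompact) fun s => (hc s.2).1)
    K ⟨hKc, hKn, hK⟩
  obtain ⟨hMc, ⟨x, hx⟩, hMT⟩ := hM.prop
  have key : ∀ y ∈ M, M ⊆ closure (orbit T y) := fun y hy =>
    hM.le_of_le ⟨isClosed_closure, ⟨y, mem_closure_orbit_self T y⟩,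
      fun _ => map_mem_closure_orbit hT⟩ (closure_orbit_subset hMT hMc hy)
  have hxM := closure_orbit_subset hMT hMc hx
  exact ⟨x, hMK hx, fun y hy => hxM.trans (key y (hxM hy))⟩

/-- If the visits of `x` to an open set are not syndetic, some point of the orbit closure of `x`
never visits that set. -/
lemma exists_forall_iterate_notMem_of_not_syndetic [CompactSpace X] {T : X → X}
    (hT : Continuous T) {O : Set X} (hO : IsOpen O) {x : X}
    (hx : ¬ Syndetic {n | T^[n] x ∈ O}) :
    ∃ y ∈ closure (orbit T x), ∀ n, T^[n] y ∉ O := by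
  have hcl : ∀ N, IsClosed (closure (orbit T x) ∩ ⋂ j ∈ Iic N, T^[j] ⁻¹' Oᶜ) := fun N =>
    isClosed_closure.inter
      (isClosed_biInter fun j _ => hO.isClosed_compl.preimage (hT.iterate j))
  obtain ⟨y, hy⟩ := IsCompact.nonempty_iInter_of_sequence_nonempty_isCompact_isClosed
    (fun N => closure (orbit T x) ∩ ⋂ j ∈ Iic N, T^[j] ⁻¹' Oᶜ)
    (fun N => inter_subset_inter_right _ (biInter_subset_biInter_left
      (Iic_subset_Iic.2 (Nat.le_succ N))))
    (fun N => by
      simp only [Syndetic, not_exists, not_forall] at hx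
      obtain ⟨i, hi⟩ := hx N
      refine ⟨T^[i] x, subset_closure ⟨i, rfl⟩, mem_iInter₂.2 fun j hj hjO => hi j ⟨hj, ?_⟩⟩
      rw [mem_ofPred_eq, add_comm, iterate_add_apply]
      exact hjO)
    (hcl 0).isCompact hcl
  rw [mem_iInter] at hy
  exact ⟨y, (hy 0).1, fun n => mem_iInter₂.1 (hy n).2 n (mem_Iic.2 le_rfl)⟩

lemma IsTransitiveSys.exists_dense_orbit [CompactSpace X] [T2Space X] [SecondCountableTopology X]
    {T : X → X} (hT : Continuous T) (h : IsTransitiveSys T) {U : Set X} (hU : IsOpen U)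
    (hUn : U.Nonempty) : ∃ x ∈ U, Dense (orbit T x) := by
  have hd : Dense (⋂ B ∈ TopologicalSpace.countableBasis X, ⋃ n : ℕ, T^[n] ⁻¹' B) := by
    refine dense_biInter_of_isOpen
      (fun B hB => isOpen_iUnion fun n =>
        (TopologicalSpace.isOpen_of_mem_countableBasis hB).preimage (hT.iterate n))
      (TopologicalSpace.countable_countableBasis X) fun B hB => dense_iff_inter_open.2 ?_
    intro W hW hWn
    obtain ⟨n, z, hz⟩ := (h W B hW (TopologicalSpace.isOpen_of_mem_countableBasis hB) hWn
      (TopologicalSpace.nonempty_of_mem_countableBasis hB)).nonempty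
    exact ⟨z, hz.1, mem_iUnion.2 ⟨n, hz.2⟩⟩
  obtain ⟨x, hxU, hx⟩ := hd.inter_open_nonempty U hU hUn
  refine ⟨x, hxU, (TopologicalSpace.isBasis_countableBasis X).dense_iff.2 fun B hB _ => ?_⟩
  obtain ⟨n, hn⟩ := mem_iUnion.1 (mem_iInter₂.1 hx B hB)
  exact ⟨T^[n] x, hn, n, rfl⟩

lemma isTransitiveSys_of_forall_exists {T : X → X} (hT : Continuous T) (hs : Surjective T)
    (h : ∀ U V : Set X, IsOpen U → IsOpen V → U.Nonempty → V.Nonempty →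
      ∃ n : ℕ, (U ∩ T^[n] ⁻¹' V).Nonempty) : IsTransitiveSys T := by
  intro U V hU hV hUn hVn
  refine infinite_of_forall_exists_gt fun N => ?_
  obtain ⟨n, z, hzU, hz⟩ := h U (T^[N + 1] ⁻¹' V) hU (hV.preimage (hT.iterate _)) hUn
    (hVn.preimage (hs.iterate _))
  refine ⟨N + 1 + n, ⟨z, hzU, ?_⟩, by omega⟩
  rw [mem_preimage, iterate_add_apply]
  exact hz

end Orbits

/-- The orbit closure of a minimal point is a minimal system. -/
lemma IsMinimalPoint.exists_tds {Z : Type} [MetricSpace Z] [CompactSpace Z] {F : Z → Z}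
    (hF : Continuous F) {z : Z} (hz : IsMinimalPoint F z) :
    ∃ 𝒴 : TDS, IsMinimalSys 𝒴.map ∧ ∃ π : 𝒴.carrier → Z, Continuous π ∧
      Semiconj π 𝒴.map F ∧ ∃ y, π y = z := by
  have hmaps : MapsTo F (closure (orbit F z)) (closure (orbit F z)) := fun _ =>
    map_mem_closure_orbit hF
  set S : closure (orbit F z) → closure (orbit F z) := hmaps.restrict
  have hSc : Continuous S := hF.restrict hmaps
  have hsemi : Semiconj Subtype.val S F := fun _ => rfl
  have hmin : IsMinimalSys S := by
    intro y w
    rw [closure_subtype]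
    have : Subtype.val '' orbit S y = orbit F y := by
      ext v
      constructor
      · rintro ⟨_, ⟨n, rfl⟩, rfl⟩
        exact ⟨n, ((hsemi.iterate_right n).eq y).symm⟩
      · rintro ⟨n, rfl⟩
        exact ⟨_, ⟨n, rfl⟩, (hsemi.iterate_right n).eq y⟩
    rw [this]
    exact hz y y.2 w.2
  have hcompact : CompactSpace (closure (orbit F z)) :=
    isCompact_iff_compactSpace.1 isClosed_closure.isCompact
  let y₀ : closure (orbit F z) := ⟨z, mem_closure_orbit_self F z⟩
  have hsurj : Surjective S := by
    rw [← range_eq_univ]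
    refine ((isCompact_range hSc).isClosed.closure_eq.symm.trans
      ((hmin (S y₀)).mono ?_).closure_eq)
    rintro _ ⟨n, rfl⟩
    exact ⟨S^[n] y₀, (iterate_succ_apply' S n y₀).symm.trans (iterate_succ_apply S n y₀)⟩
  exact ⟨⟨closure (orbit F z), S, hSc, hsurj⟩, hmin, Subtype.val, continuous_subtype_val, hsemi,
    y₀, rfl⟩

section Shift

/-- The one-sided shift. -/
def shift (y : ℕ → Bool) : ℕ → Bool := fun n => y (n + 1)

lemma continuous_shift : Continuous shift := continuous_pi fun n => continuous_apply (n + 1)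

lemma shift_iterate_apply (n : ℕ) (y : ℕ → Bool) (k : ℕ) : shift^[n] y k = y (n + k) := by
  induction n generalizing y with
  | zero => simp
  | succ n ih => rw [iterate_succ_apply, ih, shift]; congr 1; omega

lemma isMinimalPoint_shift {y : ℕ → Bool}
    (hy : ∀ m, ∃ R, ∀ i, ∃ t ≤ R, ∀ s < m, y (i + t + s) = y s) : IsMinimalPoint shift y := by
  intro z hz
  refine closure_orbit_subset (fun _ => map_mem_closure_orbit continuous_shift) isClosed_closure ?_
  refine (PiNat.isTopologicalBasis_cylinders fun _ => Bool).mem_closure_iff.2 ?_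
  rintro _ ⟨x, m, rfl⟩ hyx
  obtain ⟨R, hR⟩ := hy m
  obtain ⟨_, hw, i, rfl⟩ := mem_closure_iff.1 hz _ (PiNat.isOpen_cylinder (fun _ => Bool) z (R + m))
    (PiNat.self_mem_cylinder z (R + m))
  obtain ⟨t, ht, h⟩ := hR i
  refine ⟨shift^[t] z, fun s hs => ?_, t, rfl⟩
  rw [shift_iterate_apply, ← hw (t + s) (by omega), ← hyx s hs, ← h s hs]
  simp only [shift_iterate_apply]
  congr 1
  omega

end Shift

section Disjoint

variable {X : Type} [MetricSpace X] [CompactSpace X] {T : X → X}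

/-- If `X` is disjoint from a minimal system, pairs formed by a transitive point of `X` and any
point of the minimal system have dense orbits. -/
lemma DisjointSys.exists_iterate_mem {𝒴 : TDS} (hdisj : DisjointSys T 𝒴.map) (hT : Continuous T)
    (hmin : IsMinimalSys 𝒴.map) {x : X} (hx : Dense (orbit T x)) (y : 𝒴.carrier) {U : Set X}
    (hU : IsOpen U) (hUn : U.Nonempty) {V : Set 𝒴.carrier} (hV : IsOpen V) (hVn : V.Nonempty) :
    ∃ n, T^[n] x ∈ U ∧ 𝒴.map^[n] y ∈ V := by
  have hc : Continuous (Prod.map T 𝒴.map) := hT.prodMap 𝒴.cont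
  set J := closure (orbit (Prod.map T 𝒴.map) (x, y))
  have hJc : IsCompact J := isClosed_closure.isCompact
  have hmem : ∀ n, (T^[n] x, 𝒴.map^[n] y) ∈ J := fun n =>
    subset_closure ⟨n, by simp [Prod.map_iterate]⟩
  have huniv := hdisj J ⟨⟨_, hmem 0⟩, isClosed_closure, fun _ => map_mem_closure_orbit hc, by
    rw [← (hJc.image continuous_fst).isClosed.closure_eq]
    exact (hx.mono (show orbit T x ⊆ Prod.fst '' J from
      range_subset_iff.2 fun n => ⟨_, hmem n, rfl⟩)).closure_eq, by
    rw [← (hJc.image continuous_snd).isClosed.closure_eq]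
    exact ((hmin y).mono (show orbit 𝒴.map y ⊆ Prod.snd '' J from
      range_subset_iff.2 fun n => ⟨_, hmem n, rfl⟩)).closure_eq⟩
  obtain ⟨u, hu⟩ := hUn
  obtain ⟨v, hv⟩ := hVn
  obtain ⟨_, hw, n, rfl⟩ := mem_closure_iff.1 (huniv.symm ▸ mem_univ (u, v) : (u, v) ∈ J)
    (U ×ˢ V) (hU.prod hV) ⟨hu, hv⟩
  simp only [Prod.map_iterate] at hw
  exact ⟨n, hw⟩

/-- A transitive system disjoint from all minimal systems has dense minimal points. -/
lemma exists_isMinimalPoint_of_disjoint (hT : Continuous T) (htr : IsTransitiveSys T)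
    (hdisj : ∀ 𝒴 : TDS, IsMinimalSys 𝒴.map → DisjointSys T 𝒴.map) {U : Set X} (hU : IsOpen U)
    (hUn : U.Nonempty) : ∃ x ∈ U, IsMinimalPoint T x := by
  by_contra! hno
  obtain ⟨u, hu⟩ := hUn
  obtain ⟨ε, hε, hεU⟩ := Metric.nhds_basis_closedBall.mem_iff.1 (hU.mem_nhds hu)
  obtain ⟨x, -, hx⟩ := htr.exists_dense_orbit hT isOpen_univ ⟨u, mem_univ u⟩
  have hD : ∀ L, ∃ G, ∀ a, ∃ p ≤ G, ∀ s < L,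
      a + p + s ∈ {n | T^[n] x ∉ Metric.closedBall u ε} := by
    intro L
    let O : ℕ → Set X := fun p => ⋂ s ∈ Finset.range L, T^[p + s] ⁻¹' (Metric.closedBall u ε)ᶜ
    have hO : ∀ p, IsOpen (O p) := fun p => isOpen_biInter_finset fun s _ =>
      Metric.isClosed_closedBall.isOpen_compl.preimage (hT.iterate _)
    have hcov : univ ⊆ ⋃ p, O p := by
      intro z _
      obtain ⟨m, hm, hmm⟩ := exists_isMinimalPoint_mem hT (K := closure (orbit T z))
        (fun _ => map_mem_closure_orbit hT) isClosed_closure ⟨z, mem_closure_orbit_self T z⟩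
      have hm0 : m ∈ O 0 := by
        refine mem_iInter₂.2 fun s _ hs => ?_
        rw [zero_add] at hs
        exact hno _ (hεU hs) (hmm.of_mem_closure_orbit hT (subset_closure ⟨s, rfl⟩))
      obtain ⟨_, hw, p, rfl⟩ := mem_closure_iff.1 hm _ (hO 0) hm0
      refine mem_iUnion.2 ⟨p, mem_iInter₂.2 fun s hs => ?_⟩
      have := mem_iInter₂.1 hw s hs
      rwa [mem_preimage, ← iterate_add_apply, show 0 + s + p = p + s by omega] at this
    obtain ⟨t, ht⟩ := isCompact_univ.elim_finite_subcover O hO hcov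
    refine ⟨t.sup id, fun a => ?_⟩
    obtain ⟨p, hp, hpO⟩ := mem_iUnion₂.1 (ht (mem_univ (T^[a] x)))
    refine ⟨p, Finset.le_sup (f := id) hp, fun s hs => ?_⟩
    have := mem_iInter₂.1 hpO s (Finset.mem_range.2 hs)
    rwa [mem_preimage, ← iterate_add_apply, show p + s + a = a + p + s by omega] at this
  obtain ⟨y, hyD, ⟨k, hk⟩, hrec⟩ := exists_uniformlyRecurrent_of_thicklySyndetic hD
  let _ : MetricSpace (ℕ → Bool) := TopologicalSpace.metrizableSpaceMetric _
  obtain ⟨𝒴, hmin, π, hπ, hsemi, y₀, hy₀⟩ :=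
    (isMinimalPoint_shift hrec).exists_tds continuous_shift
  have hval : ∀ n, π (𝒴.map^[n] y₀) 0 = y n := fun n => by
    rw [(hsemi.iterate_right n).eq, hy₀, shift_iterate_apply, add_zero]
  obtain ⟨n, hn, hnV⟩ := (hdisj 𝒴 hmin).exists_iterate_mem hT hmin hx y₀ (Metric.isOpen_ball)
    ⟨u, Metric.mem_ball_self hε⟩ (V := {w | π w 0 = true})
    ((isOpen_discrete {true}).preimage ((continuous_apply 0).comp hπ))
    ⟨𝒴.map^[k] y₀, (hval k).trans hk⟩
  exact hyD n ((hval n).symm.trans hnV) (Metric.ball_subset_closedBall hn)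

lemma isWeaklyMixingSys_of_disjoint (hT : Continuous T) (hs : Surjective T)
    (htr : IsTransitiveSys T)
    (hdisj : ∀ 𝒴 : TDS, IsMinimalSys 𝒴.map → DisjointSys T 𝒴.map) : IsWeaklyMixingSys T := by
  refine isTransitiveSys_of_forall_exists (T := Prod.map T T) (hT.prodMap hT) (hs.prodMap hs) ?_
  rintro A B hA hB ⟨⟨a, a'⟩, ha⟩ ⟨⟨b, b'⟩, hb⟩
  obtain ⟨U, U', hU, hU', haU, haU', hUA⟩ := isOpen_prod_iff.1 hA a a' ha
  obtain ⟨V, V', hV, hV', hbV, hbV', hVB⟩ := isOpen_prod_iff.1 hB b b' hb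
  obtain ⟨k, hk⟩ := (htr U' V' hU' hV' ⟨_, haU'⟩ ⟨_, hbV'⟩).nonempty
  obtain ⟨z, ⟨hzU, hzV⟩, hz⟩ := exists_isMinimalPoint_of_disjoint hT htr hdisj
    (hU'.inter (hV'.preimage (hT.iterate k))) hk
  obtain ⟨x, hxU, hx⟩ := htr.exists_dense_orbit hT hU ⟨_, haU⟩
  obtain ⟨𝒴, hmin, π, hπ, hsemi, y₀, hy₀⟩ := hz.exists_tds hT
  have hval : ∀ n, π (𝒴.map^[n] y₀) = T^[n] z := fun n => by
    rw [(hsemi.iterate_right n).eq, hy₀]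
  obtain ⟨n, hn, hnV⟩ := (hdisj 𝒴 hmin).exists_iterate_mem hT hmin hx y₀ hV ⟨_, hbV⟩
    (hV'.preimage hπ) ⟨𝒴.map^[k] y₀, by rw [mem_preimage, hval]; exact hzV⟩
  rw [mem_preimage, hval] at hnV
  refine ⟨n, (x, z), hUA ⟨hxU, hzU⟩, ?_⟩
  rw [Prod.map_iterate]
  exact hVB ⟨hn, hnV⟩

lemma exists_forall_syndetic_of_disjoint (hT : Continuous T)
    (hdense : ∀ U : Set X, IsOpen U → U.Nonempty → ∃ x ∈ U, IsMinimalPoint T x) {𝒴 : TDS}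
    (hmin : IsMinimalSys 𝒴.map) (hdisj : DisjointSys T 𝒴.map) {U : Set X} (hU : IsOpen U)
    (hUn : U.Nonempty) {V : Set 𝒴.carrier} (hV : IsOpen V) (hVn : V.Nonempty) :
    ∃ x ∈ U, ∀ y ∈ V, Syndetic {n : ℕ | T^[n] x ∈ U ∧ 𝒴.map^[n] y ∈ V} := by
  by_contra! hno
  obtain ⟨u, hu⟩ := hUn
  obtain ⟨v, hv⟩ := hVn
  have hc : Continuous (Prod.map T 𝒴.map) := hT.prodMap 𝒴.cont
  set J : Set (X × 𝒴.carrier) := {p | ∀ n, (Prod.map T 𝒴.map)^[n] p ∉ U ×ˢ V} with hJ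
  have hJcl : IsClosed J := by
    rw [hJ, ofPred_forall]
    exact isClosed_iInter fun n => (hU.prod hV).isClosed_compl.preimage (hc.iterate n)
  have hJinv : ∀ p ∈ J, (T p.1, 𝒴.map p.2) ∈ J := fun p hp n => hp (n + 1)
  have hfst : Prod.fst '' J = univ := by
    have hcl := (hJcl.isCompact.image continuous_fst).isClosed
    have hinv : ∀ a ∈ Prod.fst '' J, T a ∈ Prod.fst '' J := by
      rintro _ ⟨p, hp, rfl⟩
      exact ⟨_, hJinv p hp, rfl⟩
    rw [← hcl.closure_eq]
    refine Dense.closure_eq (dense_iff_inter_open.2 fun O hO hOn => ?_)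
    obtain ⟨m, hmO, hm⟩ := hdense O hO hOn
    have hex : ∃ a ∈ closure (orbit T m), a ∈ Prod.fst '' J := by
      by_cases h : ∃ x ∈ closure (orbit T m), x ∈ U
      · obtain ⟨x, hxm, hxU⟩ := h
        obtain ⟨y, hyV, hy⟩ := hno x hxU
        obtain ⟨q, hq, hqJ⟩ := exists_forall_iterate_notMem_of_not_syndetic hc (hU.prod hV)
          (x := (x, y)) (by simpa [Prod.map_iterate] using hy)
        refine ⟨q.1, ?_, q, hqJ, rfl⟩
        exact closure_orbit_subset (K := Prod.fst ⁻¹' closure (orbit T m))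
          (fun p hp => map_mem_closure_orbit hT hp) (isClosed_closure.preimage continuous_fst)
          hxm hq
      · push Not at h
        refine ⟨m, mem_closure_orbit_self T m, (m, v), fun n hn => ?_, rfl⟩
        rw [Prod.map_iterate] at hn
        exact h _ (subset_closure ⟨n, rfl⟩) hn.1
    obtain ⟨a, ham, ha⟩ := hex
    exact ⟨m, hmO, closure_orbit_subset hinv hcl ha (hm a ham (mem_closure_orbit_self T m))⟩
  obtain ⟨p, hp, -⟩ : u ∈ Prod.fst '' J := hfst ▸ mem_univ u
  have hsnd : Prod.snd '' J = univ := by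
    rw [← (hJcl.isCompact.image continuous_snd).isClosed.closure_eq]
    exact ((hmin p.2).mono (show orbit 𝒴.map p.2 ⊆ Prod.snd '' J from range_subset_iff.2 fun n =>
      ⟨_, prodMap_iterate_mem hJinv hp n, rfl⟩)).closure_eq
  have huv : (u, v) ∈ J := hdisj J ⟨⟨p, hp⟩, hJcl, hJinv, hfst, hsnd⟩ ▸ mem_univ (u, v)
  exact huv 0 ⟨hu, hv⟩

end Disjoint

section WeaklyMixing

variable {X : Type*}

/-- In a weakly mixing system, the sets of transition times form a filter base. -/
lemma IsWeaklyMixingSys.exists_forall_nonempty [TopologicalSpace X] {T : X → X}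
    (hT : Continuous T) (h : IsWeaklyMixingSys T) {ι : Type*} (s : Finset ι) {B : ι → Set X}
    (hB : ∀ i, IsOpen (B i)) (hBn : ∀ i, (B i).Nonempty) {W : Set X} (hW : IsOpen W)
    (hWn : W.Nonempty) :
    ∃ U V : Set X, IsOpen U ∧ IsOpen V ∧ U.Nonempty ∧ V.Nonempty ∧
      ∀ n, (U ∩ T^[n] ⁻¹' V).Nonempty → ∀ i ∈ s, (W ∩ T^[n] ⁻¹' B i).Nonempty := by
  classical
  induction s using Finset.induction_on with
  | empty => exact ⟨W, W, hW, hW, hWn, hWn, by simp⟩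
  | insert i s _ ih =>
    obtain ⟨U, V, hU, hV, hUn, hVn, hUV⟩ := ih
    obtain ⟨n, ⟨a, b⟩, hab, hab'⟩ := (h (U ×ˢ V) (W ×ˢ B i) (hU.prod hV) (hW.prod (hB i))
      (hUn.prod hVn) (hWn.prod (hBn i))).nonempty
    change (Prod.map T T)^[n] (a, b) ∈ W ×ˢ B i at hab'
    rw [Prod.map_iterate] at hab'
    refine ⟨U ∩ T^[n] ⁻¹' W, V ∩ T^[n] ⁻¹' B i, hU.inter (hW.preimage (hT.iterate n)),
      hV.inter ((hB i).preimage (hT.iterate n)), ⟨a, hab.1, hab'.1⟩, ⟨b, hab.2, hab'.2⟩, ?_⟩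
    rintro k ⟨z, ⟨hzU, hzW⟩, hzV, hzB⟩ j hj
    rcases Finset.mem_insert.1 hj with rfl | hj
    · refine ⟨T^[n] z, hzW, ?_⟩
      rw [mem_preimage, ← iterate_add_apply, add_comm, iterate_add_apply]
      exact hzB
    · exact hUV k ⟨z, hzU, hzV⟩ j hj

variable [MetricSpace X] [CompactSpace X] {T : X → X}

/-- In a weakly mixing system, some image of any nonempty open set is `ε`-dense. -/
lemma IsWeaklyMixingSys.exists_iterate_dist_lt (hT : Continuous T) (h : IsWeaklyMixingSys T)
    (htr : IsTransitiveSys T) {W : Set X} (hW : IsOpen W) (hWn : W.Nonempty) {ε : ℝ}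
    (hε : 0 < ε) : ∃ n, ∀ x, ∃ z ∈ W, dist (T^[n] z) x < ε := by
  obtain ⟨t, -, ht, hcov⟩ := finite_cover_balls_of_compact (X := X) isCompact_univ (half_pos hε)
  obtain ⟨U, V, hU, hV, hUn, hVn, hUV⟩ := h.exists_forall_nonempty hT ht.toFinset
    (B := fun c => Metric.ball c (ε / 2)) (fun _ => Metric.isOpen_ball)
    (fun c => ⟨c, Metric.mem_ball_self (half_pos hε)⟩) hW hWn
  obtain ⟨n, hn⟩ := (htr U V hU hV hUn hVn).nonempty
  refine ⟨n, fun x => ?_⟩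
  obtain ⟨c, hc, hxc⟩ := mem_iUnion₂.1 (hcov (mem_univ x))
  obtain ⟨z, hzW, hz⟩ := hUV n hn c (ht.mem_toFinset.2 hc)
  refine ⟨z, hzW, (dist_triangle_right _ _ c).trans_lt ?_⟩
  rw [mem_preimage, Metric.mem_ball] at hz
  rw [Metric.mem_ball] at hxc
  linarith

/-- In a weakly mixing system, the points whose orbit stays `ε`-close to that of `x` along
arbitrarily long intervals are dense. -/
lemma IsWeaklyMixingSys.dense_setOf_dist_lt (hT : Continuous T) (h : IsWeaklyMixingSys T)
    (htr : IsTransitiveSys T) (x : X) {ε : ℝ} (hε : 0 < ε) :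
    Dense (⋂ k : ℕ, ⋃ n : ℕ, ⋂ j ∈ Finset.range (k + 1),
      {z | dist (T^[j] (T^[n] z)) (T^[j] (T^[n] x)) < ε}) := by
  refine dense_iInter_of_isOpen (fun k => isOpen_iUnion fun n => isOpen_biInter_finset fun j _ =>
    isOpen_lt (((hT.iterate j).comp (hT.iterate n)).dist continuous_const) continuous_const)
    fun k => dense_iff_inter_open.2 fun W hW hWn => ?_
  have huc : UniformContinuous fun (z : X) (j : Fin (k + 1)) => T^[j] z :=
    CompactSpace.uniformContinuous_of_continuous (continuous_pi fun j => hT.iterate j)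
  obtain ⟨δ, hδ, hδε⟩ := Metric.uniformContinuous_iff.1 huc ε hε
  obtain ⟨n, hn⟩ := h.exists_iterate_dist_lt hT htr hW hWn hδ
  obtain ⟨z, hzW, hz⟩ := hn (T^[n] x)
  refine ⟨z, hzW, mem_iUnion.2 ⟨n, mem_iInter₂.2 fun j hj => ?_⟩⟩
  exact (dist_pi_lt_iff hε).1 (hδε hz) ⟨j, Finset.mem_range.1 hj⟩

lemma IsWeaklyMixingSys.disjointSys (hT : Continuous T) (hs : Surjective T)
    (h : IsWeaklyMixingSys T) (htr : IsTransitiveSys T) {𝒴 : TDS} (hmin : IsMinimalSys 𝒴.map)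
    (hsynd : ∀ U : Set X, IsOpen U → U.Nonempty → ∀ V : Set 𝒴.carrier, IsOpen V → V.Nonempty →
      ∃ x ∈ U, ∀ y ∈ V, Syndetic {n : ℕ | T^[n] x ∈ U ∧ 𝒴.map^[n] y ∈ V}) :
    DisjointSys T 𝒴.map := by
  rintro J ⟨-, hJcl, hJinv, hfst, -⟩
  by_contra hne
  obtain ⟨⟨a, b⟩, hab⟩ := (ne_univ_iff_exists_notMem J).1 hne
  obtain ⟨U, V, hU, hV, haU, hbV, hUV⟩ := isOpen_prod_iff.1 hJcl.isOpen_compl a b hab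
  obtain ⟨ε, hε, hεU⟩ := Metric.isOpen_iff.1 hU a haU
  obtain ⟨δ, hδ, hδV⟩ := Metric.nhds_basis_closedBall.mem_iff.1 (hV.mem_nhds hbV)
  obtain ⟨x, hxU, hx⟩ := hsynd (Metric.ball a (ε / 2)) Metric.isOpen_ball
    ⟨a, Metric.mem_ball_self (half_pos hε)⟩ V hV ⟨b, hbV⟩
  let E : ℕ → Set X := fun i =>
    Prod.fst '' (J ∩ {p | 𝒴.map^[i] p.2 ∈ Metric.closedBall b δ})
  have hE : ∀ i, IsClosed (E i) := fun i =>
    ((hJcl.inter (Metric.isClosed_closedBall.preimage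
      ((𝒴.cont.iterate i).comp continuous_snd))).isCompact.image continuous_fst).isClosed
  have hEuniv : ⋃ i, E i = univ := by
    refine eq_univ_of_forall fun z => ?_
    obtain ⟨p, hp, rfl⟩ : z ∈ Prod.fst '' J := hfst ▸ mem_univ z
    obtain ⟨_, hw, i, rfl⟩ := (hmin p.2).inter_open_nonempty _ Metric.isOpen_ball
      ⟨b, Metric.mem_ball_self hδ⟩
    exact mem_iUnion.2 ⟨i, p, ⟨hp, Metric.ball_subset_closedBall hw⟩, rfl⟩
  have : Nonempty X := ⟨a⟩
  obtain ⟨i, hi⟩ := nonempty_interior_of_iUnion_of_closed hE hEuniv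
  obtain ⟨x', rfl⟩ := hs.iterate i x
  obtain ⟨z, hzE, hz⟩ := (h.dense_setOf_dist_lt hT htr x' (half_pos hε)).inter_open_nonempty _
    isOpen_interior hi
  obtain ⟨⟨z, w⟩, ⟨hp, hw⟩, rfl⟩ := interior_subset hzE
  obtain ⟨N, hN⟩ := hx (𝒴.map^[i] w) (hδV hw)
  obtain ⟨n, hn⟩ := mem_iUnion.1 (mem_iInter.1 hz (i + N))
  obtain ⟨j, hj, hxj, hwj⟩ := hN n
  have hd := mem_iInter₂.1 hn (j + i) (Finset.mem_range.2 (by omega))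
  simp only [mem_ofPred_eq, ← iterate_add_apply] at hd
  rw [← iterate_add_apply, show n + j + i = j + i + n by omega] at hxj hwj
  refine hUV ⟨hεU ?_, hwj⟩ (prodMap_iterate_mem hJinv hp (j + i + n))
  rw [Metric.mem_ball] at hxj ⊢
  linarith [dist_triangle (T^[j + i + n] z) (T^[j + i + n] x') a]

end WeaklyMixing

theorem stmt_2 {X : Type} [MetricSpace X] [CompactSpace X] (T : X → X)
    (hTc : Continuous T) (hTs : Function.Surjective T) (hTtr : IsTransitiveSys T) :
    (∀ 𝒴 : TDS, IsMinimalSys 𝒴.map → DisjointSys T 𝒴.map) ↔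
      (IsWeaklyMixingSys T ∧
        ∀ 𝒴 : TDS, IsMinimalSys 𝒴.map →
          ∀ U : Set X, IsOpen U → U.Nonempty →
            ∀ V : Set 𝒴.carrier, IsOpen V → V.Nonempty →
              ∃ x ∈ U, ∀ y ∈ V, Syndetic {n : ℕ | T^[n] x ∈ U ∧ 𝒴.map^[n] y ∈ V}) := by
  constructor
  · intro h
    refine ⟨isWeaklyMixingSys_of_disjoint hTc hTs hTtr h, fun 𝒴 hmin U hU hUn V hV hVn => ?_⟩
    exact exists_forall_syndetic_of_disjoint hTc
      (fun _ => exists_isMinimalPoint_of_disjoint hTc hTtr h) hmin (h 𝒴 hmin) hU hUn hV hVn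
  · rintro ⟨hwm, h⟩ 𝒴 hmin
    exact hwm.disjointSys hTc hTs hTtr hmin (h 𝒴 hmin)
end

section
/- Let (X,T) be a transitive topological dynamical system. Then (X,T) is disjoint from every minimal topological dynamical system if and only if (X,T) is weakly mixing and for every minimal t.d.s. (Y,S), every nonempty open set U ⊆ X and every nonempty open set V ⊆ Y, there exists a minimal point x ∈ U of (X,T) (depending only on U and V) such that for every y ∈ V the set N_{T×S}((x,y), U×V) = {n ∈ ℤ₊ : T^n x ∈ U and S^n y ∈ V} is syndetic. -/
open Set Function Filter Topology

section Words

/-- The word `w` can be written from position `i` on so that all its `true` letters land in `D`. -/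
def FitsAt (D : ℕ → Prop) (i : ℕ) (w : List Bool) : Prop :=
  ∀ j, w[j]? = some true → D (i + j)

theorem FitsAt.append {D : ℕ → Prop} {i : ℕ} {a b : List Bool} (ha : FitsAt D i a)
    (hb : FitsAt D (i + a.length) b) : FitsAt D i (a ++ b) := by
  intro j hj
  rw [List.getElem?_append] at hj
  split_ifs at hj with h
  · exact ha j hj
  · have := hb _ hj
    rwa [show i + a.length + (j - a.length) = i + j by omega] at this

/-- A finite family of nonempty words one of which can be placed at every position. -/
structure IsTilingFamily (D : ℕ → Prop) (W : Language Bool) : Prop where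
  finite : Set.Finite (W : Set (List Bool))
  ne_nil : ∀ w ∈ W, w ≠ []
  exists_fitsAt : ∀ i, ∃ w ∈ W, FitsAt D i w

theorem IsTilingFamily.exists_length_le {D : ℕ → Prop} {W : Language Bool}
    (hW : IsTilingFamily D W) : ∃ B, ∀ w ∈ W, w.length ≤ B := by
  obtain ⟨B, hB⟩ := (hW.finite.image List.length).bddAbove
  exact ⟨B, fun w hw => hB ⟨w, hw, rfl⟩⟩

theorem append_mem_kstar {W : Language Bool} {a b : List Bool} (ha : a ∈ KStar.kstar W)
    (hb : b ∈ KStar.kstar W) : a ++ b ∈ KStar.kstar W := by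
  rw [← kstar_mul_kstar]
  exact Language.append_mem_mul ha hb

theorem mem_kstar_of_mem {W : Language Bool} {a : List Bool} (ha : a ∈ W) :
    a ∈ KStar.kstar W :=
  (le_kstar : W ≤ KStar.kstar W) ha

theorem IsTilingFamily.exists_kstar_fitsAt {D : ℕ → Prop} {W : Language Bool}
    (hW : IsTilingFamily D W) {B : ℕ} (hB : ∀ w ∈ W, w.length ≤ B) {i : ℕ} {w : List Bool}
    (hw : w ∈ W) (hwi : FitsAt D i w) (n : ℕ) :
    ∃ l ∈ KStar.kstar W, w <+: l ∧ FitsAt D i l ∧ n ≤ l.length ∧ l.length ≤ n + B := by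
  induction n with
  | zero =>
    exact ⟨w, mem_kstar_of_mem hw, List.prefix_refl _, hwi, by simp, by simpa using hB w hw⟩
  | succ n ih =>
    obtain ⟨l, hl, hwl, hli, h1, h2⟩ := ih
    by_cases h : n + 1 ≤ l.length
    · exact ⟨l, hl, hwl, hli, h, by omega⟩
    · obtain ⟨v, hv, hvi⟩ := hW.exists_fitsAt (i + l.length)
      have := List.length_pos_iff.2 (hW.ne_nil v hv)
      have := hB v hv
      refine ⟨l ++ v, append_mem_kstar hl (mem_kstar_of_mem hv),
        hwl.trans (List.prefix_append _ _), hli.append hvi, ?_, ?_⟩ <;>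
      · rw [List.length_append]; omega

theorem IsTilingFamily.exists_kstar_covering {D : ℕ → Prop} {W : Language Bool}
    (hW : IsTilingFamily D W) :
    ∃ u ∈ KStar.kstar W, u ≠ [] ∧ ∀ v ∈ W, v <:+: u := by
  have hmem : ∀ v, v ∈ hW.finite.toFinset.toList ↔ v ∈ W := fun v => by
    rw [Finset.mem_toList]
    exact hW.finite.mem_toFinset
  have hinf : ∀ v ∈ W, v <:+: hW.finite.toFinset.toList.flatten := fun v hv => by
    obtain ⟨s, t, hst⟩ := List.append_of_mem ((hmem v).2 hv)
    exact ⟨s.flatten, t.flatten, by rw [hst]; simp⟩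
  refine ⟨hW.finite.toFinset.toList.flatten,
    Language.mem_kstar.2 ⟨_, rfl, fun y hy => (hmem y).1 hy⟩, fun h => ?_, hinf⟩
  obtain ⟨w, hw, -⟩ := hW.exists_fitsAt 0
  have := hinf w hw
  rw [h, List.infix_nil] at this
  exact hW.ne_nil w hw this

/-- The words of the second language are concatenations of words of the first, each using all of
them. -/
structure Refines (W W' : Language Bool) : Prop where
  le_kstar : W' ≤ KStar.kstar W
  isInfix_of_mem : ∀ v ∈ W, ∀ v' ∈ W', v <:+: v'

theorem IsTilingFamily.exists_refines {D : ℕ → Prop}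
    (hD : ∀ L, ∃ g, ∀ i, ∃ n ≤ g, ∀ j ≤ L, D (i + n + j)) {W : Language Bool}
    (hW : IsTilingFamily D W) :
    ∃ W', IsTilingFamily D W' ∧ Refines W W' ∧ ∀ i, ∀ w ∈ W, FitsAt D i w →
      ∃ w' ∈ W', FitsAt D i w' ∧ w <+: w' ∧ w.length < w'.length := by
  obtain ⟨u, hu, hu0, huW⟩ := hW.exists_kstar_covering
  obtain ⟨B, hB⟩ := hW.exists_length_le
  obtain ⟨g, hg⟩ := hD (B + u.length)
  let W' : Language Bool := {w' | w' ∈ KStar.kstar W ∧ w' ≠ [] ∧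
    w'.length ≤ g + B + u.length ∧ ∀ v ∈ W, v <:+: w'}
  have key : ∀ i, ∀ w ∈ W, FitsAt D i w →
      ∃ w' ∈ W', FitsAt D i w' ∧ w <+: w' ∧ w.length < w'.length := by
    intro i w hw hwi
    obtain ⟨n, hn, hnD⟩ := hg i
    obtain ⟨l, hl, hwl, hli, h1, h2⟩ := hW.exists_kstar_fitsAt hB hw hwi n
    have hupos := List.length_pos_iff.2 hu0
    have hwlen := hwl.length_le
    refine ⟨l ++ u, ⟨append_mem_kstar hl hu, by simp [hu0], ?_, fun v hv =>
      (huW v hv).trans (List.suffix_append _ _).isInfix⟩, hli.append fun j hj => ?_,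
      hwl.trans (List.prefix_append _ _), ?_⟩
    · rw [List.length_append]; omega
    · obtain ⟨hj', -⟩ := List.getElem?_eq_some_iff.1 hj
      have := hnD (l.length - n + j) (by omega)
      rwa [show i + n + (l.length - n + j) = i + l.length + j by omega] at this
    · rw [List.length_append]; omega
  refine ⟨W', ⟨(List.finite_length_le Bool (g + B + u.length)).subset fun w hw => hw.2.2.1,
    fun w hw => hw.2.1, fun i => ?_⟩, ⟨fun w hw => hw.1, fun v hv v' hv' => hv'.2.2.2 v hv⟩, key⟩
  obtain ⟨w, hw, hwi⟩ := hW.exists_fitsAt i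
  obtain ⟨w', hw', hwi', -⟩ := key i w hw hwi
  exact ⟨w', hw', hwi'⟩

theorem exists_occurrence_flatten {B : ℕ} {v : List Bool} {vs : List (List Bool)}
    (hvs : ∀ u ∈ vs, v <:+: u ∧ u.length ≤ B) {i : ℕ} (hi : i + 2 * B < vs.flatten.length) :
    ∃ a b, vs.flatten = a ++ v ++ b ∧ i ≤ a.length ∧ a.length ≤ i + 2 * B := by
  induction vs generalizing i with
  | nil => simp at hi
  | cons u vs ih =>
    simp only [List.mem_cons, forall_eq_or_imp] at hvs
    obtain ⟨⟨⟨s, t, hst⟩, huB⟩, hvs⟩ := hvs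
    rw [List.flatten_cons, List.length_append] at hi
    have hlen := congrArg List.length hst
    simp only [List.length_append] at hlen
    rcases Nat.eq_zero_or_pos i with rfl | hpos
    · exact ⟨s, t ++ vs.flatten, by rw [List.flatten_cons, ← hst]; simp, by omega, by omega⟩
    rcases le_or_gt u.length i with h | h
    · obtain ⟨a, b, hab, h1, h2⟩ := ih hvs (i := i - u.length) (by omega)
      refine ⟨u ++ a, b, by rw [List.flatten_cons, hab]; simp, ?_, ?_⟩ <;>
      · rw [List.length_append]; omega
    · cases vs with
      | nil => simp at hi; omega
      | cons u₂ vs =>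
        obtain ⟨⟨s₂, t₂, hst₂⟩, huB₂⟩ := hvs u₂ (by simp)
        have hlen₂ := congrArg List.length hst₂
        simp only [List.length_append] at hlen₂
        refine ⟨u ++ s₂, t₂ ++ vs.flatten, by rw [List.flatten_cons, List.flatten_cons, ← hst₂]; simp,
          ?_, ?_⟩ <;>
        · rw [List.length_append]; omega

/-- A thickly syndetic set supports a nonzero uniformly recurrent sequence. -/
theorem exists_uniformly_recurrent {D : ℕ → Prop}
    (hD : ∀ L, ∃ g, ∀ i, ∃ n ≤ g, ∀ j ≤ L, D (i + n + j)) :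
    ∃ ω : ℕ → Bool, (∃ n, ω n = true) ∧ (∀ n, ω n = true → D n) ∧
      ∀ k, ∃ N, ∀ i, ∃ j ≤ N, ∀ r < k, ω (i + j + r) = ω r := by
  let State := {p : Language Bool × List Bool //
    IsTilingFamily D p.1 ∧ p.2 ∈ p.1 ∧ FitsAt D 0 p.2}
  have hstep : ∀ p : State, ∃ q : State, Refines p.1.1 q.1.1 ∧ p.1.2 <+: q.1.2 ∧
      p.1.2.length < q.1.2.length := by
    rintro ⟨⟨W, w⟩, hW, hw, hw0⟩
    obtain ⟨W', hW', href, h⟩ := hW.exists_refines hD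
    obtain ⟨w', hw', hw0', hpre, hlt⟩ := h 0 w hw hw0
    exact ⟨⟨⟨W', w'⟩, hW', hw', hw0'⟩, href, hpre, hlt⟩
  choose next hnext using hstep
  have hfalse : ∀ i, FitsAt D i [false] := fun i j hj => by
    rcases j with _ | j <;> simp at hj
  let start : State := ⟨⟨({[true], [false]} : Set (List Bool)), [false]⟩,
    ⟨Set.toFinite _, by rintro w (rfl | rfl) <;> simp,
      fun i => ⟨[false], Or.inr rfl, hfalse i⟩⟩, Or.inr rfl, hfalse 0⟩
  let s : ℕ → State := fun n => next^[n] start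
  have hs : ∀ n, s (n + 1) = next (s n) := fun n => Function.iterate_succ_apply' _ _ _
  let W : ℕ → Language Bool := fun n => (s n).1.1
  let w : ℕ → List Bool := fun n => (s n).1.2
  have hWt : ∀ n, IsTilingFamily D (W n) := fun n => (s n).2.1
  have hw : ∀ n, w n ∈ W n := fun n => (s n).2.2.1
  have hfit : ∀ n, FitsAt D 0 (w n) := fun n => (s n).2.2.2
  have href : ∀ n, Refines (W n) (W (n + 1)) := fun n => by
    simp only [W, hs]; exact (hnext (s n)).1
  have hpre : ∀ n, w n <+: w (n + 1) := fun n => by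
    simp only [w, hs]; exact (hnext (s n)).2.1
  have hlt : ∀ n, (w n).length < (w (n + 1)).length := fun n => by
    simp only [w, hs]; exact (hnext (s n)).2.2
  have hmono : ∀ m n, m ≤ n → w m <+: w n := fun m n h => by
    induction n, h using Nat.le_induction with
    | base => exact List.prefix_refl _
    | succ n _ ih => exact ih.trans (hpre n)
  have hlen : ∀ n, n ≤ (w n).length := fun n => by
    induction n with
    | zero => simp
    | succ n ih => have := hlt n; omega
  have hstar : ∀ m n, m ≤ n → W n ≤ KStar.kstar (W m) := fun m n h => by
    induction n, h using Nat.le_induction with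
    | base => exact le_kstar
    | succ n _ ih =>
      refine (href n).le_kstar.trans ?_
      have := kstar_mono ih
      rwa [kstar_idem] at this
  let ω : ℕ → Bool := fun n => ((w (n + 1))[n]?).getD false
  have hω : ∀ m j (h : j < (w m).length), ω j = (w m)[j] := by
    intro m j h
    have h' : j < (w (j + 1)).length := hlen (j + 1)
    have e : ω j = (w (j + 1))[j] := by simp [ω, List.getElem?_eq_getElem h']
    rw [e]
    rcases le_total m (j + 1) with hm | hm
    · exact ((hmono _ _ hm).getElem h).symm
    · exact (hmono _ _ hm).getElem h'
  refine ⟨ω, ?_, ?_, ?_⟩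
  · obtain ⟨a, b, hab⟩ := (href 0).isInfix_of_mem [true] (Or.inl rfl) _ (hw 1)
    have hl : a.length < (w 1).length := by rw [← hab]; simp
    refine ⟨a.length, ?_⟩
    rw [hω 1 _ hl]
    simp [← hab]
  · intro n hn
    have h' : n < (w (n + 1)).length := hlen (n + 1)
    rw [hω (n + 1) n h'] at hn
    have := hfit (n + 1) n (by rw [List.getElem?_eq_getElem h', hn])
    rwa [zero_add] at this
  · intro k
    obtain ⟨B, hB⟩ := (hWt (k + 1)).exists_length_le
    refine ⟨2 * B, fun i => ?_⟩
    obtain ⟨vs, hvs, hvsW⟩ := Language.mem_kstar.1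
      (hstar (k + 1) (k + 1 + (i + 2 * B + 1)) (by omega) (hw _))
    have hl := hlen (k + 1 + (i + 2 * B + 1))
    obtain ⟨a, b, hab, h1, h2⟩ := exists_occurrence_flatten (v := w k) (vs := vs) (i := i) (B := B)
      (fun u hu => ⟨(href k).isInfix_of_mem _ (hw k) _ (hvsW u hu), hB u (hvsW u hu)⟩)
      (by rw [← hvs]; omega)
    refine ⟨a.length - i, by omega, fun r hr => ?_⟩
    have hr' : r < (w k).length := hr.trans_le (hlen k)
    rw [show i + (a.length - i) + r = a.length + r by omega, hω k r hr']
    have hl' : a.length + r < (w (k + 1 + (i + 2 * B + 1))).length := by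
      rw [hvs, hab]; simp only [List.length_append]; omega
    rw [hω _ _ hl']
    simp [hvs, hab, hr']

end Words

section Orbits

theorem mem_orbit_self {Z : Type*} (R : Z → Z) (z : Z) : z ∈ orbit R z := ⟨0, rfl⟩

theorem iterate_mem_of_invariant {Z : Type*} {R : Z → Z} {C : Set Z} (hinv : ∀ z ∈ C, R z ∈ C)
    {z : Z} (hz : z ∈ C) (n : ℕ) : R^[n] z ∈ C :=
  Set.MapsTo.iterate (f := R) (fun z hz => hinv z hz) n hz

theorem map_mem_setOf_forall_iterate_notMem {Z : Type*} {R : Z → Z} {G : Set Z} {z : Z}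
    (hz : ∀ n, R^[n] z ∉ G) (n : ℕ) : R^[n] (R z) ∉ G := by
  rw [← Function.iterate_succ_apply]
  exact hz (n + 1)

variable {Z : Type*} [TopologicalSpace Z] {R : Z → Z}

theorem closure_orbit_subset_s3 {C : Set Z} (hC : IsClosed C) (hinv : ∀ z ∈ C, R z ∈ C) {z : Z}
    (hz : z ∈ C) : closure (orbit R z) ⊆ C := by
  refine closure_minimal ?_ hC
  rintro _ ⟨n, rfl⟩
  exact iterate_mem_of_invariant hinv hz n

theorem map_mem_closure_orbit_s3 (hR : Continuous R) {x z : Z} (hz : z ∈ closure (orbit R x)) :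
    R z ∈ closure (orbit R x) := by
  refine map_mem_closure hR hz ?_
  rintro _ ⟨n, rfl⟩
  exact ⟨n + 1, Function.iterate_succ_apply' _ _ _⟩

theorem exists_iterate_mem_of_mem_closure_orbit {x z : Z} {G : Set Z} (hG : IsOpen G)
    (hz : z ∈ closure (orbit R x)) (hzG : z ∈ G) : ∃ n, R^[n] x ∈ G := by
  obtain ⟨_, hn, n, rfl⟩ := mem_closure_iff.1 hz G hG hzG
  exact ⟨n, hn⟩

theorem IsCompact.exists_hitting_bound (hR : Continuous R) {K G : Set Z} (hK : IsCompact K)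
    (hG : IsOpen G) (h : ∀ z ∈ K, ∃ n, R^[n] z ∈ G) : ∃ N, ∀ z ∈ K, ∃ n ≤ N, R^[n] z ∈ G := by
  obtain ⟨t, ht⟩ := hK.elim_finite_subcover (fun n => R^[n] ⁻¹' G)
    (fun n => hG.preimage (hR.iterate n)) fun z hz => Set.mem_iUnion.2 (h z hz)
  refine ⟨t.sup id, fun z hz => ?_⟩
  obtain ⟨n, hn, hzn⟩ := Set.mem_iUnion₂.1 (ht hz)
  exact ⟨n, Finset.le_sup (f := id) hn, hzn⟩

theorem isClosed_setOf_forall_iterate_notMem (hR : Continuous R) {G : Set Z} (hG : IsOpen G) :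
    IsClosed {z | ∀ n, R^[n] z ∉ G} := by
  rw [Set.ofPred_forall]
  exact isClosed_iInter fun n => hG.isClosed_compl.preimage (hR.iterate n)

theorem IsMinimalPoint.of_mem_closure_orbit_s3 (hR : Continuous R) {x z : Z}
    (hx : IsMinimalPoint R x) (hz : z ∈ closure (orbit R x)) : IsMinimalPoint R z := by
  have hsub : closure (orbit R z) ⊆ closure (orbit R x) :=
    closure_orbit_subset_s3 isClosed_closure (fun _ => map_mem_closure_orbit_s3 hR) hz
  exact fun y hy => hsub.trans (hx y (hsub hy))

theorem IsMinimalPoint.syndetic [CompactSpace Z] (hR : Continuous R) {x : Z}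
    (hx : IsMinimalPoint R x) {G : Set Z} (hG : IsOpen G) (hxG : x ∈ G) :
    Syndetic {n | R^[n] x ∈ G} := by
  obtain ⟨N, hN⟩ := (isClosed_closure (s := orbit R x)).isCompact.exists_hitting_bound hR hG
    fun z hz => exists_iterate_mem_of_mem_closure_orbit hG
      (hx z hz (subset_closure (mem_orbit_self R x))) hxG
  refine ⟨N, fun i => ?_⟩
  obtain ⟨j, hj, hjG⟩ := hN (R^[i] x) (subset_closure ⟨i, rfl⟩)
  refine ⟨j, hj, ?_⟩
  rwa [← Function.iterate_add_apply, add_comm] at hjG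

theorem isMinimalPoint_of_syndetic [RegularSpace Z] (hR : Continuous R) {x : Z}
    (h : ∀ G ∈ 𝓝 x, Syndetic {n | R^[n] x ∈ G}) : IsMinimalPoint R x := by
  intro y hy
  refine closure_orbit_subset_s3 isClosed_closure (fun _ => map_mem_closure_orbit_s3 hR) ?_
  refine mem_closure_iff_nhds.2 fun G hG => ?_
  obtain ⟨C, hC, hCc, hCG⟩ := exists_mem_nhds_isClosed_subset hG
  obtain ⟨N, hN⟩ := h C hC
  have hcl : IsClosed (⋃ j ∈ Set.Iic N, R^[j] ⁻¹' C) :=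
    (Set.finite_Iic N).isClosed_biUnion fun j _ => hCc.preimage (hR.iterate j)
  have hsub : closure (orbit R x) ⊆ ⋃ j ∈ Set.Iic N, R^[j] ⁻¹' C := by
    refine closure_minimal ?_ hcl
    rintro _ ⟨i, rfl⟩
    obtain ⟨j, hj, hjC⟩ := hN i
    refine Set.mem_iUnion₂.2 ⟨j, hj, ?_⟩
    rw [Set.mem_preimage, ← Function.iterate_add_apply, add_comm]
    exact hjC
  obtain ⟨j, -, hjC⟩ := Set.mem_iUnion₂.1 (hsub hy)
  exact ⟨_, hCG hjC, j, rfl⟩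

theorem exists_isMinimalPoint_mem_closure_orbit [CompactSpace Z] (hR : Continuous R) (x : Z) :
    ∃ m ∈ closure (orbit R x), IsMinimalPoint R m := by
  obtain ⟨M, hMx, hM⟩ := zorn_superset_nonempty
    {C : Set Z | IsClosed C ∧ C.Nonempty ∧ ∀ z ∈ C, R z ∈ C} (fun c hc hchain hne => by
      refine ⟨⋂₀ c, ⟨isClosed_sInter fun C hC => (hc hC).1, ?_, fun z hz C hC =>
        (hc hC).2.2 z (hz C hC)⟩, fun C hC => Set.sInter_subset_of_mem hC⟩
      have := hne.to_subtype
      rw [Set.sInter_eq_iInter]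
      exact IsCompact.nonempty_iInter_of_directed_nonempty_isCompact_isClosed _
        (fun A B => (hchain.total A.2 B.2).elim (fun h => ⟨A, subset_rfl, h⟩)
          fun h => ⟨B, h, subset_rfl⟩) (fun C => (hc C.2).2.1)
        (fun C => (hc C.2).1.isCompact) fun C => (hc C.2).1)
    (closure (orbit R x)) ⟨isClosed_closure, ⟨x, subset_closure (mem_orbit_self R x)⟩,
      fun _ => map_mem_closure_orbit_s3 hR⟩
  obtain ⟨m, hm⟩ := hM.prop.2.1
  have hsub : ∀ z ∈ M, closure (orbit R z) ⊆ M := fun z hz =>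
    closure_orbit_subset_s3 hM.prop.1 hM.prop.2.2 hz
  refine ⟨m, hMx hm, fun y hy => (hsub m hm).trans ?_⟩
  exact hM.le_of_le ⟨isClosed_closure, ⟨y, subset_closure (mem_orbit_self R y)⟩,
    fun _ => map_mem_closure_orbit_s3 hR⟩ (hsub y (hsub m hm hy))

theorem IsMinimalSys.eq_univ (hR : IsMinimalSys R) {C : Set Z} (hC : IsClosed C)
    (hne : C.Nonempty) (hinv : ∀ z ∈ C, R z ∈ C) : C = Set.univ := by
  obtain ⟨z, hz⟩ := hne
  exact Set.univ_subset_iff.1 ((hR z).closure_eq ▸ closure_orbit_subset_s3 hC hinv hz)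

theorem IsMinimalSys.exists_hitting_bound [CompactSpace Z] (hc : Continuous R)
    (hR : IsMinimalSys R) {G : Set Z} (hG : IsOpen G) (hne : G.Nonempty) :
    ∃ N, ∀ z, ∃ n ≤ N, R^[n] z ∈ G := by
  obtain ⟨g, hg⟩ := hne
  obtain ⟨N, hN⟩ := isCompact_univ.exists_hitting_bound hc hG fun z _ =>
    exists_iterate_mem_of_mem_closure_orbit hG (hR z g) hg
  exact ⟨N, fun z => hN z trivial⟩

/-- The orbit closure of a minimal point, as a minimal system. -/
theorem IsMinimalPoint.exists_tds_s3 {Z : Type} [TopologicalSpace Z] [CompactSpace Z]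
    [TopologicalSpace.MetrizableSpace Z] {R : Z → Z} (hR : Continuous R) {x : Z}
    (hx : IsMinimalPoint R x) :
    ∃ 𝒴 : TDS, IsMinimalSys 𝒴.map ∧ ∃ f : 𝒴.carrier → Z, Continuous f ∧
      (∀ n y, f (𝒴.map^[n] y) = R^[n] (f y)) ∧ ∃ y, f y = x := by
  let K : Set Z := closure (orbit R x)
  have hKR : Set.MapsTo R K K := fun _ => map_mem_closure_orbit_s3 hR
  have : CompactSpace K := isCompact_iff_compactSpace.1 isClosed_closure.isCompact
  let S : K → K := hKR.restrict R K K
  have hS : Continuous S := hR.restrict hKR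
  have hiter : ∀ n (y : K), ((S^[n] y : K) : Z) = R^[n] y := fun n => by
    induction n with
    | zero => exact fun _ => rfl
    | succ n ih => exact fun y => ih (S y)
  have hmin : IsMinimalSys S := by
    intro y z
    rw [closure_subtype]
    have : ((↑) '' orbit S y : Set Z) = orbit R (y : Z) := by
      rw [orbit, orbit, ← Set.range_comp]
      exact congrArg Set.range (funext fun n => hiter n y)
    rw [this]
    exact hx y y.2 z.2
  have hsurj : Function.Surjective S := Set.range_eq_univ.1 <|
    hmin.eq_univ (isCompact_range hS).isClosed
      ⟨_, ⟨x, subset_closure (mem_orbit_self R x)⟩, rfl⟩ fun z _ => ⟨z, rfl⟩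
  let _ : MetricSpace K := TopologicalSpace.metrizableSpaceMetric K
  exact ⟨⟨K, S, hS, hsurj⟩, hmin, Subtype.val, continuous_subtype_val, hiter,
    ⟨x, subset_closure (mem_orbit_self R x)⟩, rfl⟩

theorem IsTransitiveSys.exists_iterate (hR : IsTransitiveSys R) {U V : Set Z} (hU : IsOpen U)
    (hV : IsOpen V) (hUne : U.Nonempty) (hVne : V.Nonempty) :
    ∃ n, (U ∩ R^[n] ⁻¹' V).Nonempty :=
  (hR U V hU hV hUne hVne).nonempty

theorem IsTransitiveSys.exists_dense_orbit_s3 [BaireSpace Z] [SecondCountableTopology Z] [Nonempty Z]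
    (hc : Continuous R) (hR : IsTransitiveSys R) : ∃ x, Dense (orbit R x) := by
  let B := TopologicalSpace.countableBasis Z
  have hB := TopologicalSpace.isBasis_countableBasis Z
  have : Countable B := (TopologicalSpace.countable_countableBasis Z).to_subtype
  have hd : Dense (⋂ b : B, ⋃ n, R^[n] ⁻¹' (b : Set Z)) := by
    refine dense_iInter_of_isOpen
      (fun b => isOpen_iUnion fun n => (hB.isOpen b.2).preimage (hc.iterate n)) fun b => ?_
    refine dense_iff_inter_open.2 fun U hU hUne => ?_
    obtain ⟨n, z, hzU, hz⟩ := hR.exists_iterate hU (hB.isOpen b.2) hUne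
      (TopologicalSpace.nonempty_of_mem_countableBasis b.2)
    exact ⟨z, hzU, Set.mem_iUnion.2 ⟨n, hz⟩⟩
  obtain ⟨x, hx⟩ := hd.nonempty
  refine ⟨x, hB.dense_iff.2 fun b hb _ => ?_⟩
  obtain ⟨n, hn⟩ := Set.mem_iUnion.1 (Set.mem_iInter.1 hx ⟨b, hb⟩)
  exact ⟨_, hn, n, rfl⟩

theorem IsTransitiveSys.dense_of_subset (hR : IsTransitiveSys R) {C U : Set Z}
    (hinv : ∀ z ∈ C, R z ∈ C) (hU : IsOpen U) (hUne : U.Nonempty) (hUC : U ⊆ C) : Dense C := by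
  refine dense_iff_inter_open.2 fun V hV hVne => ?_
  obtain ⟨n, z, hzU, hz⟩ := hR.exists_iterate hU hV hUne hVne
  exact ⟨_, hz, iterate_mem_of_invariant hinv (hUC hzU) n⟩

end Orbits

section Joinings

variable {X Y : Type*} [TopologicalSpace X] [CompactSpace X] [T2Space X] [TopologicalSpace Y]
  [CompactSpace Y] [T2Space Y] {T : X → X} {S : Y → Y}

theorem DisjointSys.eq_univ (h : DisjointSys T S) (hS : IsMinimalSys S) {J : Set (X × Y)}
    (hJ : IsClosed J) (hne : J.Nonempty) (hinv : ∀ p ∈ J, (T p.1, S p.2) ∈ J)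
    (hd : Dense (Prod.fst '' J)) : J = Set.univ := by
  refine h J ⟨hne, hJ, hinv, ?_, ?_⟩
  · exact (hJ.isCompact.image continuous_fst).isClosed.closure_eq ▸ hd.closure_eq
  · refine hS.eq_univ (hJ.isCompact.image continuous_snd).isClosed (hne.image _) ?_
    rintro _ ⟨p, hp, rfl⟩
    exact ⟨_, hinv p hp, rfl⟩

/-- Two points whose forward orbits under `T × S` avoid a nonempty open set obstruct disjointness
as soon as they project densely. -/
theorem DisjointSys.not_dense (h : DisjointSys T S) (hT : Continuous T) (hSc : Continuous S)
    (hS : IsMinimalSys S) {U : Set X} {V : Set Y} (hU : IsOpen U) (hV : IsOpen V)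
    (hUne : U.Nonempty) (hVne : V.Nonempty)
    (hd : Dense (Prod.fst '' {p : X × Y | ∀ n, (Prod.map T S)^[n] p ∉ U ×ˢ V})) : False := by
  obtain ⟨u, hu⟩ := hUne
  obtain ⟨v, hv⟩ := hVne
  have : Nonempty X := ⟨u⟩
  have huniv := h.eq_univ hS (isClosed_setOf_forall_iterate_notMem (hT.prodMap hSc) (hU.prod hV))
    hd.nonempty.of_image (fun p hp => map_mem_setOf_forall_iterate_notMem hp) hd
  have huv : (u, v) ∈ {p : X × Y | ∀ n, (Prod.map T S)^[n] p ∉ U ×ˢ V} := huniv ▸ trivial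
  exact huv 0 ⟨hu, hv⟩

end Joinings

section Forward

variable {X : Type} [MetricSpace X] [CompactSpace X] {T : X → X}

theorem exists_isMinimalPoint_mem_of_disjoint (hTc : Continuous T) (hTtr : IsTransitiveSys T)
    (h : ∀ 𝒴 : TDS, IsMinimalSys 𝒴.map → DisjointSys T 𝒴.map) {U : Set X} (hU : IsOpen U)
    (hUne : U.Nonempty) : ∃ x ∈ U, IsMinimalPoint T x := by
  by_contra! hcon
  have : Nonempty X := hUne.to_type
  obtain ⟨x₀, hx₀⟩ := hTtr.exists_dense_orbit_s3 hTc
  obtain ⟨u, hu⟩ := hUne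
  obtain ⟨C, hC, hCc, hCU⟩ := exists_mem_nhds_isClosed_subset (hU.mem_nhds hu)
  have hthick : ∀ L, ∃ g, ∀ i, ∃ n ≤ g, ∀ j ≤ L, T^[i + n + j] x₀ ∉ C := by
    intro L
    have hG : IsOpen (⋂ j ∈ Set.Iic L, T^[j] ⁻¹' Cᶜ) :=
      (Set.finite_Iic L).isOpen_biInter fun j _ => hCc.isOpen_compl.preimage (hTc.iterate j)
    obtain ⟨g, hg⟩ := isCompact_univ.exists_hitting_bound hTc hG fun z _ => by
      obtain ⟨m, hm, hmmin⟩ := exists_isMinimalPoint_mem_closure_orbit hTc z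
      refine exists_iterate_mem_of_mem_closure_orbit hG hm (Set.mem_iInter₂.2 fun j _ hj => ?_)
      exact hcon _ (hCU hj) (hmmin.of_mem_closure_orbit_s3 hTc (subset_closure ⟨j, rfl⟩))
    refine ⟨g, fun i => ?_⟩
    obtain ⟨n, hn, hnG⟩ := hg (T^[i] x₀) trivial
    refine ⟨n, hn, fun j hj => ?_⟩
    have := Set.mem_iInter₂.1 hnG j hj
    rwa [Set.mem_preimage, ← Function.iterate_add_apply, ← Function.iterate_add_apply,
      show j + n + i = i + n + j by omega] at this
  obtain ⟨ω, ⟨n₁, hn₁⟩, hωD, hωrec⟩ := exists_uniformly_recurrent (D := fun n => T^[n] x₀ ∉ C) hthick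
  let σ : (ℕ → Bool) → (ℕ → Bool) := fun ξ n => ξ (n + 1)
  have hσ : Continuous σ := continuous_pi fun n => continuous_apply (n + 1)
  have hσn : ∀ n ξ m, σ^[n] ξ m = ξ (n + m) := fun n => by
    induction n with
    | zero => simp
    | succ n ih =>
      intro ξ m
      rw [Function.iterate_succ_apply, ih]
      exact congrArg ξ (by omega)
  have hωmin : IsMinimalPoint σ ω := by
    refine isMinimalPoint_of_syndetic hσ fun G hG => ?_
    rw [nhds_pi, Filter.mem_pi] at hG
    obtain ⟨I, hI, t, ht, htG⟩ := hG
    obtain ⟨b, hb⟩ := hI.bddAbove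
    obtain ⟨N, hN⟩ := hωrec (b + 1)
    refine ⟨N, fun i => ?_⟩
    obtain ⟨j, hj, hjr⟩ := hN i
    refine ⟨j, hj, htG fun r hr => ?_⟩
    rw [hσn, hjr r (Nat.lt_succ_of_le (hb hr))]
    exact mem_of_mem_nhds (ht r)
  obtain ⟨𝒴, h𝒴, f, hf, hfn, y₀, hy₀⟩ := hωmin.exists_tds_s3 hσ
  have hO : IsOpen {y | f y 0 = true} :=
    (isOpen_discrete {true}).preimage ((continuous_apply 0).comp hf)
  refine (h 𝒴 h𝒴).not_dense hTc 𝒴.cont h𝒴 isOpen_interior hO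
    ⟨u, mem_interior_iff_mem_nhds.2 hC⟩ ⟨𝒴.map^[n₁] y₀, ?_⟩ (hx₀.mono ?_)
  · rw [Set.mem_ofPred_eq, hfn, hy₀, hσn]
    exact hn₁
  · rintro _ ⟨k, rfl⟩
    refine ⟨(T^[k] x₀, 𝒴.map^[k] y₀), fun n hn => ?_, rfl⟩
    rw [Prod.map_iterate, Prod.map_apply, ← Function.iterate_add_apply,
      ← Function.iterate_add_apply] at hn
    have h2 := hn.2
    rw [Set.mem_ofPred_eq, hfn, hy₀, hσn] at h2
    exact hωD _ h2 (interior_subset hn.1)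

theorem isWeaklyMixingSys_of_return {Z : Type*} [TopologicalSpace Z] {R : Z → Z}
    (hc : Continuous R) (hs : Function.Surjective R) (hR : IsTransitiveSys R)
    (h : ∀ P Q W : Set Z, IsOpen P → IsOpen Q → IsOpen W → P.Nonempty → Q.Nonempty → W.Nonempty →
      ∃ n, (P ∩ R^[n] ⁻¹' Q).Nonempty ∧ (W ∩ R^[n] ⁻¹' W).Nonempty) :
    IsWeaklyMixingSys R := by
  have hpre : ∀ {G : Set Z} (n : ℕ), IsOpen G → G.Nonempty →
      IsOpen (R^[n] ⁻¹' G) ∧ (R^[n] ⁻¹' G).Nonempty := fun n hG hne =>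
    ⟨hG.preimage (hc.iterate n), hne.preimage (hs.iterate n)⟩
  have key : ∀ A B C D : Set Z, IsOpen A → IsOpen B → IsOpen C → IsOpen D → A.Nonempty →
      B.Nonempty → C.Nonempty → D.Nonempty →
      ∃ n, (A ∩ R^[n] ⁻¹' B).Nonempty ∧ (C ∩ R^[n] ⁻¹' D).Nonempty := by
    intro A B C D hA hB hC hD hA' hB' hC' hD'
    obtain ⟨n, hn⟩ := hR.exists_iterate hA hB hA' hB'
    obtain ⟨k, ⟨p, hpC, hpD⟩, ⟨w, hwW, hw⟩⟩ := h C (R^[n] ⁻¹' D) (A ∩ R^[n] ⁻¹' B) hC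
      (hpre n hD hD').1 (hA.inter (hB.preimage (hc.iterate n))) hC' (hpre n hD hD').2 hn
    refine ⟨n + k, ⟨w, hwW.1, ?_⟩, p, hpC, ?_⟩ <;>
      rw [Set.mem_preimage, Function.iterate_add_apply]
    · exact hw.2
    · exact hpD
  intro U V hU hV ⟨⟨a, c⟩, hac⟩ ⟨⟨b, d⟩, hbd⟩
  obtain ⟨A, C, hA, hC, ha, hc', hAC⟩ := isOpen_prod_iff.1 hU a c hac
  obtain ⟨B, D, hB, hD, hb, hd, hBD⟩ := isOpen_prod_iff.1 hV b d hbd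
  refine Set.infinite_of_forall_exists_gt fun j => ?_
  obtain ⟨n, ⟨p, hpA, hpB⟩, q, hqC, hqD⟩ := key A (R^[j + 1] ⁻¹' B) C (R^[j + 1] ⁻¹' D) hA
    (hpre _ hB ⟨b, hb⟩).1 hC (hpre _ hD ⟨d, hd⟩).1 ⟨a, ha⟩ (hpre _ hB ⟨b, hb⟩).2 ⟨c, hc'⟩
    (hpre _ hD ⟨d, hd⟩).2
  refine ⟨j + 1 + n, ⟨(p, q), hAC ⟨hpA, hqC⟩, ?_⟩, by omega⟩
  have hm : (fun p : Z × Z => (R p.1, R p.2)) = Prod.map R R := rfl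
  rw [Set.mem_preimage, hm, Prod.map_iterate]
  refine hBD ⟨?_, ?_⟩
  · change R^[j + 1 + n] p ∈ B
    rw [Function.iterate_add_apply]
    exact hpB
  · change R^[j + 1 + n] q ∈ D
    rw [Function.iterate_add_apply]
    exact hqD

theorem isWeaklyMixingSys_of_disjoint_s3 (hTc : Continuous T) (hTs : Function.Surjective T)
    (hTtr : IsTransitiveSys T) (h : ∀ 𝒴 : TDS, IsMinimalSys 𝒴.map → DisjointSys T 𝒴.map) :
    IsWeaklyMixingSys T := by
  refine isWeaklyMixingSys_of_return hTc hTs hTtr fun P Q W hP hQ hW hP' hQ' hW' => ?_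
  obtain ⟨m, hmW, hm⟩ := exists_isMinimalPoint_mem_of_disjoint hTc hTtr h hW hW'
  obtain ⟨𝒴, h𝒴, f, hf, hfn, y₀, rfl⟩ := hm.exists_tds_s3 hTc
  have : Nonempty X := ⟨f y₀⟩
  obtain ⟨x₀, hx₀⟩ := hTtr.exists_dense_orbit_s3 hTc
  obtain ⟨_, hxP, k, rfl⟩ := hx₀.inter_open_nonempty P hP hP'
  by_contra! hcon
  have hVo : IsOpen (f ⁻¹' W) := hW.preimage hf
  refine (h 𝒴 h𝒴).not_dense hTc 𝒴.cont h𝒴 hQ hVo hQ' ⟨y₀, hmW⟩ ?_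
  refine hTtr.dense_of_subset ?_ hP hP' fun x hx => ⟨(x, y₀), fun n hn => ?_, rfl⟩
  · rintro _ ⟨p, hp, rfl⟩
    exact ⟨_, map_mem_setOf_forall_iterate_notMem hp, rfl⟩
  · rw [Prod.map_iterate] at hn
    refine (hcon n ⟨x, hx, hn.1⟩).subset ⟨hmW, ?_⟩
    rw [Set.mem_preimage, ← hfn]
    exact hn.2

theorem exists_isMinimalPoint_syndetic_of_disjoint (hTc : Continuous T)
    (hTtr : IsTransitiveSys T) (h : ∀ 𝒴 : TDS, IsMinimalSys 𝒴.map → DisjointSys T 𝒴.map)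
    (𝒴 : TDS) (h𝒴 : IsMinimalSys 𝒴.map) {U : Set X} (hU : IsOpen U) (hUne : U.Nonempty)
    {V : Set 𝒴.carrier} (hV : IsOpen V) (hVne : V.Nonempty) :
    ∃ x ∈ U, IsMinimalPoint T x ∧
      ∀ y, Syndetic {n : ℕ | T^[n] x ∈ U ∧ 𝒴.map^[n] y ∈ V} := by
  by_contra! hcon
  have hinv : ∀ x ∈ Prod.fst '' {p : X × 𝒴.carrier | ∀ n, (Prod.map T 𝒴.map)^[n] p ∉ U ×ˢ V},
      T x ∈ Prod.fst '' {p : X × 𝒴.carrier | ∀ n, (Prod.map T 𝒴.map)^[n] p ∉ U ×ˢ V} := by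
    rintro _ ⟨p, hp, rfl⟩
    exact ⟨_, map_mem_setOf_forall_iterate_notMem hp, rfl⟩
  have hcl : IsClosed
      (Prod.fst '' {p : X × 𝒴.carrier | ∀ n, (Prod.map T 𝒴.map)^[n] p ∉ U ×ˢ V}) :=
    ((isClosed_setOf_forall_iterate_notMem (hTc.prodMap 𝒴.cont)
      (hU.prod hV)).isCompact.image continuous_fst).isClosed
  refine (h 𝒴 h𝒴).not_dense hTc 𝒴.cont h𝒴 hU hV hUne hVne
    (hTtr.dense_of_subset hinv hU hUne fun x hx => ?_)
  rw [← hcl.closure_eq]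
  refine mem_closure_iff.2 fun O hO hxO => ?_
  obtain ⟨m, ⟨hmO, hmU⟩, hm⟩ := exists_isMinimalPoint_mem_of_disjoint hTc hTtr h
    (hO.inter hU) ⟨x, hxO, hx⟩
  refine ⟨m, hmO, ?_⟩
  obtain ⟨y, hy⟩ := hcon m hmU hm
  by_contra hmQ
  refine hy ?_
  obtain ⟨N, hN⟩ := ((isClosed_closure (s := orbit T m)).isCompact.prod
    (isCompact_univ (X := 𝒴.carrier))).exists_hitting_bound (hTc.prodMap 𝒴.cont) (hU.prod hV)
    fun p hp => by
      by_contra! hpQ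
      exact hmQ (closure_orbit_subset_s3 hcl hinv ⟨p, hpQ, rfl⟩
        (hm p.1 hp.1 (subset_closure (mem_orbit_self T m))))
  refine ⟨N, fun i => ?_⟩
  obtain ⟨j, hj, hjUV⟩ := hN (T^[i] m, 𝒴.map^[i] y) ⟨subset_closure ⟨i, rfl⟩, trivial⟩
  rw [Prod.map_iterate, Prod.map_apply, ← Function.iterate_add_apply,
    ← Function.iterate_add_apply, add_comm j i] at hjUV
  exact ⟨j, hj, hjUV⟩

end Forward

section Backward

theorem IsWeaklyMixingSys.exists_iterate {Z : Type*} [TopologicalSpace Z] {R : Z → Z}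
    (h : IsWeaklyMixingSys R) {A B C D : Set Z} (hA : IsOpen A) (hB : IsOpen B) (hC : IsOpen C)
    (hD : IsOpen D) (hA' : A.Nonempty) (hB' : B.Nonempty) (hC' : C.Nonempty) (hD' : D.Nonempty) :
    ∃ n, (A ∩ R^[n] ⁻¹' B).Nonempty ∧ (C ∩ R^[n] ⁻¹' D).Nonempty := by
  obtain ⟨n, p, hp, hpn⟩ := IsTransitiveSys.exists_iterate h (hA.prod hC) (hB.prod hD)
    (hA'.prod hC') (hB'.prod hD')
  have hm : (fun p : Z × Z => (R p.1, R p.2)) = Prod.map R R := rfl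
  rw [Set.mem_preimage, hm, Prod.map_iterate] at hpn
  exact ⟨n, ⟨p.1, hp.1, hpn.1⟩, p.2, hp.2, hpn.2⟩

theorem IsWeaklyMixingSys.thick {Z : Type*} [TopologicalSpace Z] {R : Z → Z}
    (hc : Continuous R) (hs : Function.Surjective R) (h : IsWeaklyMixingSys R) {A B : Set Z}
    (hA : IsOpen A) (hB : IsOpen B) (hA' : A.Nonempty) (hB' : B.Nonempty) :
    Thick {n | (A ∩ R^[n] ⁻¹' B).Nonempty} := by
  intro L
  suffices ∃ E F : Set Z, IsOpen E ∧ IsOpen F ∧ E.Nonempty ∧ F.Nonempty ∧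
      ∀ n, (E ∩ R^[n] ⁻¹' F).Nonempty → ∀ j ≤ L, (A ∩ R^[n + j] ⁻¹' B).Nonempty by
    obtain ⟨E, F, hE, hF, hE', hF', hEF⟩ := this
    obtain ⟨n, hn, -⟩ := h.exists_iterate hE hF hE hF hE' hF' hE' hF'
    exact ⟨n, hEF n hn⟩
  induction L with
  | zero =>
    refine ⟨A, B, hA, hB, hA', hB', fun n hn j hj => ?_⟩
    obtain rfl : j = 0 := by omega
    exact hn
  | succ L ih =>
    obtain ⟨E, F, hE, hF, hE', hF', hEF⟩ := ih
    have hBL : IsOpen (R^[L + 1] ⁻¹' B) := hB.preimage (hc.iterate _)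
    obtain ⟨k, hk₁, hk₂⟩ := h.exists_iterate hE hA hF hBL hE' hA' hF'
      (hB'.preimage (hs.iterate _))
    refine ⟨_, _, hE.inter (hA.preimage (hc.iterate k)), hF.inter (hBL.preimage (hc.iterate k)),
      hk₁, hk₂, ?_⟩
    rintro n ⟨z, ⟨hzE, hzA⟩, hzF, hzB⟩ j hj
    rcases Nat.le_succ_iff.1 hj with hj | rfl
    · exact hEF n ⟨z, hzE, hzF⟩ j hj
    · refine ⟨_, hzA, ?_⟩
      rw [Set.mem_preimage, Set.mem_preimage, ← Function.iterate_add_apply,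
        ← Function.iterate_add_apply] at hzB
      rwa [Set.mem_preimage, ← Function.iterate_add_apply,
        show n + L.succ + k = L + 1 + k + n by omega]

/-- In a weakly mixing system some point visits `W` at prescribed shifts of return times of a
minimal point of `W`. -/
theorem IsWeaklyMixingSys.exists_shifted_returns {Z : Type*} [TopologicalSpace Z] [CompactSpace Z]
    {R : Z → Z} (hc : Continuous R) (hs : Function.Surjective R) (h : IsWeaklyMixingSys R) {x : Z}
    (hx : IsMinimalPoint R x) {W : Set Z} (hW : IsOpen W) (hxW : x ∈ W) (M : ℕ) :
    ∃ z, ∀ m < M, ∃ a, R^[a] x ∈ W ∧ R^[a + m] z ∈ W := by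
  suffices ∃ A : Set Z, IsOpen A ∧ A.Nonempty ∧
      ∀ z ∈ A, ∀ m < M, ∃ a, R^[a] x ∈ W ∧ R^[a + m] z ∈ W by
    obtain ⟨A, -, ⟨z, hz⟩, hA⟩ := this
    exact ⟨z, hA z hz⟩
  obtain ⟨L, hL⟩ := hx.syndetic hc hW hxW
  induction M with
  | zero => exact ⟨Set.univ, isOpen_univ, ⟨x, trivial⟩, fun z _ m hm => by omega⟩
  | succ M ih =>
    obtain ⟨A, hA, hA', hAM⟩ := ih
    obtain ⟨n, hn⟩ := h.thick hc hs hA (hW.preimage (hc.iterate M)) hA'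
      (Set.Nonempty.preimage ⟨x, hxW⟩ (hs.iterate M)) L
    obtain ⟨j, hj, hjW⟩ := hL n
    refine ⟨_, hA.inter ((hW.preimage (hc.iterate M)).preimage (hc.iterate (n + j))), hn j hj,
      fun z hz m hm => ?_⟩
    rcases Nat.lt_succ_iff_lt_or_eq.1 hm with hm | rfl
    · exact hAM z hz.1 m hm
    · refine ⟨n + j, hjW, ?_⟩
      rw [add_comm, Function.iterate_add_apply]
      exact hz.2

theorem disjointSys_of_isWeaklyMixingSys {X Y : Type*} [MetricSpace X] [CompactSpace X]
    [MetricSpace Y] [CompactSpace Y] {T : X → X} {S : Y → Y} (hTc : Continuous T)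
    (hTs : Function.Surjective T) (hSc : Continuous S) (hS : IsMinimalSys S)
    (hwm : IsWeaklyMixingSys T)
    (h : ∀ U : Set X, IsOpen U → U.Nonempty → ∀ V : Set Y, IsOpen V → V.Nonempty →
      ∃ x ∈ U, IsMinimalPoint T x ∧ ∀ y ∈ V, Syndetic {n : ℕ | T^[n] x ∈ U ∧ S^[n] y ∈ V}) :
    DisjointSys T S := by
  rintro J ⟨-, hJ, hinv, hfst, -⟩
  refine Set.eq_univ_of_forall fun p => ?_
  by_contra hp
  obtain ⟨U₀, V₀, hU₀, hV₀, hpU, hpV, hUV⟩ := isOpen_prod_iff.1 hJ.isOpen_compl p.1 p.2 hp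
  obtain ⟨r, hr, hrU⟩ := Metric.isOpen_iff.1 hU₀ _ hpU
  obtain ⟨δ, hδ, hδV⟩ := Metric.nhds_basis_closedBall.mem_iff.1 (hV₀.mem_nhds hpV)
  obtain ⟨x, hxU, hx, hxV⟩ := h (Metric.ball p.1 (r / 2)) Metric.isOpen_ball
    ⟨p.1, Metric.mem_ball_self (by positivity)⟩ (Metric.ball p.2 δ) Metric.isOpen_ball
    ⟨p.2, Metric.mem_ball_self hδ⟩
  let E : ℕ → Set Y := fun N => ⋂ i : ℕ, ⋃ j ∈ Set.Iic N,
    {y | T^[i + j] x ∈ Metric.ball p.1 (r / 2) ∧ S^[i + j] y ∈ Metric.closedBall p.2 δ}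
  have hE : ∀ N, IsClosed (E N) := fun N => isClosed_iInter fun i =>
    (Set.finite_Iic N).isClosed_biUnion fun j _ =>
      isClosed_const.inter (Metric.isClosed_closedBall.preimage (hSc.iterate (i + j)))
  have hcover : ⋃ N, (E N ∪ (Metric.ball p.2 δ)ᶜ) = Set.univ := by
    refine Set.eq_univ_of_forall fun y => ?_
    by_cases hy : y ∈ Metric.ball p.2 δ
    · obtain ⟨N, hN⟩ := hxV y hy
      refine Set.mem_iUnion.2 ⟨N, Or.inl (Set.mem_iInter.2 fun i => ?_)⟩
      obtain ⟨j, hj, hj₁, hj₂⟩ := hN i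
      exact Set.mem_iUnion₂.2 ⟨j, hj, hj₁, Metric.ball_subset_closedBall hj₂⟩
    · exact Set.mem_iUnion.2 ⟨0, Or.inr hy⟩
  have : Nonempty Y := ⟨p.2⟩
  obtain ⟨v, hvV, hv⟩ := (dense_iUnion_interior_of_closed
    (fun N => (hE N).union Metric.isOpen_ball.isClosed_compl) hcover).inter_open_nonempty
    (Metric.ball p.2 δ) Metric.isOpen_ball ⟨p.2, Metric.mem_ball_self hδ⟩
  obtain ⟨N, hvN⟩ := Set.mem_iUnion.1 hv
  obtain ⟨M, hM⟩ := hS.exists_hitting_bound hSc (Metric.isOpen_ball.inter isOpen_interior)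
    ⟨v, hvV, hvN⟩
  have hWo : IsOpen (⋂ n ∈ Set.Iic N, {w | dist (T^[n] w) (T^[n] x) < r / 4}) :=
    (Set.finite_Iic N).isOpen_biInter fun n _ =>
      isOpen_lt ((hTc.iterate n).dist continuous_const) continuous_const
  have hxW : x ∈ ⋂ n ∈ Set.Iic N, {w | dist (T^[n] w) (T^[n] x) < r / 4} :=
    Set.mem_iInter₂.2 fun n _ => by
      rw [Set.mem_ofPred_eq, dist_self]
      positivity
  obtain ⟨z, hz⟩ := hwm.exists_shifted_returns hTc hTs hx hWo hxW (M + 1)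
  obtain ⟨⟨z', y⟩, hzy, hzz⟩ : z ∈ Prod.fst '' J := hfst ▸ trivial
  obtain rfl : z' = z := hzz
  obtain ⟨m, hm, hmV, hmE⟩ := hM y
  obtain ⟨a, ha, haz⟩ := hz m (Nat.lt_succ_of_le hm)
  obtain ⟨n, hn, hnx, hny⟩ := Set.mem_iUnion₂.1
    (Set.mem_iInter.1 ((interior_subset hmE).resolve_right fun hc => hc hmV) a)
  have hd₁ := Set.mem_iInter₂.1 ha n hn
  have hd₂ := Set.mem_iInter₂.1 haz n hn
  rw [Set.mem_ofPred_eq, ← Function.iterate_add_apply] at hd₁ hd₂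
  rw [add_comm a n, Metric.mem_ball] at hnx
  rw [← Function.iterate_add_apply] at hny
  have hJn : (Prod.map T S)^[n + (a + m)] (z', y) ∈ J := iterate_mem_of_invariant hinv hzy _
  rw [Prod.map_iterate] at hJn
  refine hUV ⟨hrU ?_, hδV ?_⟩ hJn
  · rw [Prod.map_fst, Metric.mem_ball]
    have h₁ := dist_triangle4 (T^[n + (a + m)] z') (T^[n] x) (T^[n + a] x) p.1
    rw [dist_comm (T^[n] x)] at h₁
    linarith
  · rwa [Prod.map_snd, show n + (a + m) = a + n + m by omega]

end Backward

theorem stmt_3 {X : Type} [MetricSpace X] [CompactSpace X] (T : X → X)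
    (hTc : Continuous T) (hTs : Function.Surjective T) (hTtr : IsTransitiveSys T) :
    (∀ 𝒴 : TDS, IsMinimalSys 𝒴.map → DisjointSys T 𝒴.map) ↔
      (IsWeaklyMixingSys T ∧
        ∀ 𝒴 : TDS, IsMinimalSys 𝒴.map →
          ∀ U : Set X, IsOpen U → U.Nonempty →
            ∀ V : Set 𝒴.carrier, IsOpen V → V.Nonempty →
              ∃ x ∈ U, IsMinimalPoint T x ∧
                ∀ y ∈ V, Syndetic {n : ℕ | T^[n] x ∈ U ∧ 𝒴.map^[n] y ∈ V}) := by
  refine ⟨fun h => ⟨isWeaklyMixingSys_of_disjoint_s3 hTc hTs hTtr h,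
    fun 𝒴 h𝒴 U hU hUne V hV hVne => ?_⟩, fun h 𝒴 h𝒴 =>
    disjointSys_of_isWeaklyMixingSys hTc hTs 𝒴.cont h𝒴 h.1 (h.2 𝒴 h𝒴)⟩
  obtain ⟨x, hxU, hx, hxV⟩ :=
    exists_isMinimalPoint_syndetic_of_disjoint hTc hTtr h 𝒴 h𝒴 hU hUne hV hVne
  exact ⟨x, hxU, hx, fun y _ => hxV y⟩
end
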